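/- arXiv:2001.10868 — 2 statements merged into one kernel-verified Lean document; each statement's English description precedes it below -/
import Mathlib

section
/- Let s > 1/2 and R > 0, and assume φ₀, η₀ ∈ B_R^s. Then there exists a constant L > 0 depending on R such that for every τ > 0 and every ε ∈ (0,1], the Strang splitting operator satisfies the stability estimate ‖S_τ(φ₀) − S_τ(η₀)‖_s ≤ (1 + L ε^p τ) ‖φ₀ − η₀‖_s. -/
/- Periodic functions on Ω = (a,b) are represented by their Fourier coefficient
sequences `c : ℤ → ℂ`, i.e. `z(x) = ∑_{l∈ℤ} c l * exp(i μ_l (x−a))` with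
`μ_l = 2πl/(b−a)`.  All operators are expressed on the Fourier side:
`⟨∇⟩`, `⟨∇⟩⁻¹`, `e^{it⟨∇⟩}` act diagonally, complex conjugation of the function
corresponds to `l ↦ conj (c (−l))`, and the pointwise product of two functions
corresponds to the convolution of their coefficient sequences. -/

noncomputable section

namespace NKGE

/-- Fourier frequency `μ_l = 2πl/(b−a)`. -/
def mu (a b : ℝ) (l : ℤ) : ℝ := 2 * Real.pi * l / (b - a)

/-- `ζ_l = √(1+μ_l²)`, the Fourier symbol of `⟨∇⟩ = √(1−∂_xx)`. -/
def zeta (a b : ℝ) (l : ℤ) : ℝ := Real.sqrt (1 + mu a b l ^ 2)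

/-- Squared `H^s`-norm: `‖z‖_s² = ∑_l (1+μ_l²)^s |ẑ_l|²`. -/
def sobNormSq (a b s : ℝ) (c : ℤ → ℂ) : ℝ := ∑' l : ℤ, (1 + mu a b l ^ 2) ^ s * ‖c l‖ ^ 2

/-- The `H^s`-norm `‖z‖_s`. -/
def sobNorm (a b s : ℝ) (c : ℤ → ℂ) : ℝ := Real.sqrt (sobNormSq a b s c)

/-- Membership in `H^s(Ω)`. -/
def MemHs (a b s : ℝ) (c : ℤ → ℂ) : Prop :=
  Summable fun l : ℤ => (1 + mu a b l ^ 2) ^ s * ‖c l‖ ^ 2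

/-- The operator `⟨∇⟩` acting in Fourier space. -/
def opJ (a b : ℝ) (c : ℤ → ℂ) : ℤ → ℂ := fun l => (zeta a b l : ℂ) * c l

/-- The operator `⟨∇⟩⁻¹` acting in Fourier space. -/
def opJinv (a b : ℝ) (c : ℤ → ℂ) : ℤ → ℂ := fun l => c l / (zeta a b l : ℂ)

/-- The operator `e^{it⟨∇⟩}` acting in Fourier space. -/
def expJ (a b t : ℝ) (c : ℤ → ℂ) : ℤ → ℂ :=
  fun l => Complex.exp (Complex.I * (t : ℂ) * (zeta a b l : ℂ)) * c l

/-- Fourier coefficients of the complex conjugate function `z̄`. -/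
def conjC (c : ℤ → ℂ) : ℤ → ℂ := fun l => (starRingEnd ℂ) (c (-l))

/-- Convolution of coefficient sequences = coefficients of the pointwise product. -/
def convC (c d : ℤ → ℂ) : ℤ → ℂ := fun l => ∑' m : ℤ, c m * d (l - m)

/-- Coefficients of the constant function `1`. -/
def oneC : ℤ → ℂ := fun l => if l = 0 then 1 else 0

/-- Coefficients of the `n`-th pointwise power `z^n`. -/
def powC (c : ℤ → ℂ) : ℕ → ℤ → ℂ
  | 0 => oneC
  | n + 1 => convC c (powC c n)

/-- Coefficients of `(ψ + ψ̄)/2`. -/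
def reC (c : ℤ → ℂ) : ℤ → ℂ := fun l => (c l + conjC c l) / 2

/-- Coefficients of `φ + φ̄`. -/
def addConj (c : ℤ → ℂ) : ℤ → ℂ := fun l => c l + conjC c l

/-- `G(φ) = f((φ+φ̄)/2)` with `f(v) = v^{p+1}`. -/
def Gop (p : ℕ) (c : ℤ → ℂ) : ℤ → ℂ := powC (reC c) (p + 1)

/-- `F(φ) = i ⟨∇⟩⁻¹ G(φ)`. -/
def Fop (a b : ℝ) (p : ℕ) (c : ℤ → ℂ) : ℤ → ℂ := fun l => Complex.I * opJinv a b (Gop p c) l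

/-- `F_t(φ) = e^{−it⟨∇⟩} F(e^{it⟨∇⟩} φ)`. -/
def Ft (a b : ℝ) (p : ℕ) (t : ℝ) (c : ℤ → ℂ) : ℤ → ℂ :=
  expJ a b (-t) (Fop a b p (expJ a b t c))

/-- `F'(φ)(η) = ((p+1)i/2^{p+1}) ⟨∇⟩⁻¹((φ+φ̄)^p (η+η̄))`. -/
def Fd (a b : ℝ) (p : ℕ) (φ η : ℤ → ℂ) : ℤ → ℂ :=
  fun l => ((p : ℂ) + 1) * Complex.I / 2 ^ (p + 1) *
    opJinv a b (convC (powC (addConj φ) p) (addConj η)) l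

/-- `F_t'(φ)(η) = e^{−it⟨∇⟩} F'(e^{it⟨∇⟩}φ)(e^{it⟨∇⟩}η)`. -/
def Ftd (a b : ℝ) (p : ℕ) (t : ℝ) (φ η : ℤ → ℂ) : ℤ → ℂ :=
  expJ a b (-t) (Fd a b p (expJ a b t φ) (expJ a b t η))

/-- `F''(φ)(η,ζ) = (p(p+1)i/2^{p+1}) ⟨∇⟩⁻¹((φ+φ̄)^{p−1}(η+η̄)(ζ+ζ̄))`. -/
def Fdd (a b : ℝ) (p : ℕ) (φ η ζ : ℤ → ℂ) : ℤ → ℂ :=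
  fun l => (p : ℂ) * ((p : ℂ) + 1) * Complex.I / 2 ^ (p + 1) *
    opJinv a b (convC (convC (powC (addConj φ) (p - 1)) (addConj η)) (addConj ζ)) l

/-- `F_t''(φ)(η,ζ) = e^{−it⟨∇⟩} F''(e^{it⟨∇⟩}φ)(e^{it⟨∇⟩}η, e^{it⟨∇⟩}ζ)`. -/
def Ftdd (a b : ℝ) (p : ℕ) (t : ℝ) (φ η ζ : ℤ → ℂ) : ℤ → ℂ :=
  expJ a b (-t) (Fdd a b p (expJ a b t φ) (expJ a b t η) (expJ a b t ζ))

/-- The flow `φ_V^t(ψ₀) = ψ₀ + ε^p t F(ψ₀)` of the nonlinear subproblem. -/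
def flowV (a b : ℝ) (p : ℕ) (ε t : ℝ) (c : ℤ → ℂ) : ℤ → ℂ :=
  fun l => c l + (ε ^ p * t) • Fop a b p c l

/-- The Strang splitting operator `S_τ = φ_T^{τ/2} ∘ φ_V^{τ} ∘ φ_T^{τ/2}`. -/
def strang (a b : ℝ) (p : ℕ) (ε τ : ℝ) (c : ℤ → ℂ) : ℤ → ℂ :=
  expJ a b (τ / 2) (flowV a b p ε τ (expJ a b (τ / 2) c))

/-- The alternative Strang splitting `S̃_τ = φ_V^{τ/2} ∘ φ_T^{τ} ∘ φ_V^{τ/2}`. -/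
def strang2 (a b : ℝ) (p : ℕ) (ε τ : ℝ) (c : ℤ → ℂ) : ℤ → ℂ :=
  flowV a b p ε (τ / 2) (expJ a b τ (flowV a b p ε (τ / 2) c))

/-- `Ψ` is an exact solution of the relativistic NLSE
`i∂_tψ + ⟨∇⟩ψ + ε^p ⟨∇⟩⁻¹ G(ψ) = 0`, written on the Fourier side, i.e.
`ψ' = i(ζ_l ψ_l + ε^p ζ_l⁻¹ (G(ψ))_l)`. -/
def IsExactSol (a b : ℝ) (p : ℕ) (ε : ℝ) (Ψ : ℝ → ℤ → ℂ) : Prop :=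
  ∀ (t : ℝ) (l : ℤ), HasDerivAt (fun s => Ψ s l)
    (Complex.I * ((zeta a b l : ℂ) * Ψ t l + (ε ^ p : ℂ) * Gop p (Ψ t) l / (zeta a b l : ℂ))) t

/-- Pointwise-in-`t` derivative `∂_t F_t(φ)`. -/
def dFt (a b : ℝ) (p : ℕ) (t : ℝ) (c : ℤ → ℂ) : ℤ → ℂ :=
  fun l => deriv (fun τ => Ft a b p τ c l) t

/-- Second derivative `∂_t² F_t(φ)`. -/
def d2Ft (a b : ℝ) (p : ℕ) (t : ℝ) (c : ℤ → ℂ) : ℤ → ℂ :=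
  fun l => deriv (fun τ => dFt a b p τ c l) t

/-- Derivative `∂_t F_t'(φ)(η)`. -/
def dFtd (a b : ℝ) (p : ℕ) (t : ℝ) (φ η : ℤ → ℂ) : ℤ → ℂ :=
  fun l => deriv (fun τ => Ftd a b p τ φ η l) t


lemma cs_aux (f g : ℤ → ℝ) (hf : ∀ i, 0 ≤ f i) (hg : ∀ i, 0 ≤ g i)
    (sf : Summable fun i => f i ^ 2) (sg : Summable fun i => g i ^ 2) :
    Summable (fun i => f i * g i) ∧
      (∑' i, f i * g i) ^ 2 ≤ (∑' i, f i ^ 2) * (∑' i, g i ^ 2) := by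
  have h1 : Summable (fun i => f i * g i) := by
    refine Summable.of_nonneg_of_le (fun i => mul_nonneg (hf i) (hg i)) (fun i => ?_) (sf.add sg)
    nlinarith [sq_nonneg (f i - g i), sq_nonneg (f i), sq_nonneg (g i)]
  refine ⟨h1, ?_⟩
  have h2 : (∑' i, f i * g i) ≤ Real.sqrt ((∑' i, f i ^ 2) * (∑' i, g i ^ 2)) := by
    refine h1.tsum_le_of_sum_le (fun t => ?_)
    apply Real.le_sqrt_of_sq_le
    refine (Finset.sum_mul_sq_le_sq_mul_sq t f g).trans ?_
    have a1 := sf.sum_le_tsum t (fun i _ => sq_nonneg (f i))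
    have a2 := sg.sum_le_tsum t (fun i _ => sq_nonneg (g i))
    exact mul_le_mul a1 a2 (Finset.sum_nonneg fun i _ => sq_nonneg _)
      (tsum_nonneg fun i => sq_nonneg _)
  have h3 : 0 ≤ ∑' i, f i * g i := tsum_nonneg fun i => mul_nonneg (hf i) (hg i)
  have h4 : 0 ≤ (∑' i, f i ^ 2) * (∑' i, g i ^ 2) :=
    mul_nonneg (tsum_nonneg fun i => sq_nonneg _) (tsum_nonneg fun i => sq_nonneg _)
  calc _ ≤ (Real.sqrt ((∑' i, f i ^ 2) * (∑' i, g i ^ 2))) ^ 2 := by gcongr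
    _ = _ := Real.sq_sqrt h4

/-- the weight -/
def wt (a b s : ℝ) (l : ℤ) : ℝ := (1 + mu a b l ^ 2) ^ s

lemma wt_pos (a b s : ℝ) (l : ℤ) : 0 < wt a b s l := by
  unfold wt; positivity

lemma sobNorm_nonneg (a b s : ℝ) (c : ℤ → ℂ) : 0 ≤ sobNorm a b s c := Real.sqrt_nonneg _

lemma sobNorm_sq (a b s : ℝ) (c : ℤ → ℂ) :
    sobNorm a b s c ^ 2 = ∑' l, wt a b s l * ‖c l‖ ^ 2 := by
  unfold sobNorm
  rw [Real.sq_sqrt]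
  · rfl
  · exact tsum_nonneg fun l => mul_nonneg (wt_pos a b s l).le (sq_nonneg _)

lemma mono_aux (a b s : ℝ) (c d : ℤ → ℂ) (h : ∀ l, ‖c l‖ ≤ ‖d l‖) (hd : MemHs a b s d) :
    MemHs a b s c ∧ sobNorm a b s c ≤ sobNorm a b s d := by
  have hle : ∀ l, wt a b s l * ‖c l‖ ^ 2 ≤ wt a b s l * ‖d l‖ ^ 2 := fun l => by
    have := (wt_pos a b s l).le
    have := h l
    gcongr
  have hc : MemHs a b s c :=
    Summable.of_nonneg_of_le (fun l => mul_nonneg (wt_pos a b s l).le (sq_nonneg _)) hle hd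
  refine ⟨hc, Real.sqrt_le_sqrt ?_⟩
  exact Summable.tsum_le_tsum hle hc hd

lemma smul_aux (a b s : ℝ) (k : ℂ) (c : ℤ → ℂ) (hc : MemHs a b s c) :
    MemHs a b s (fun l => k * c l) ∧
      sobNorm a b s (fun l => k * c l) = ‖k‖ * sobNorm a b s c := by
  have e : (fun l => (1 + mu a b l ^ 2) ^ s * ‖k * c l‖ ^ 2) =
      fun l => ‖k‖ ^ 2 * ((1 + mu a b l ^ 2) ^ s * ‖c l‖ ^ 2) := by
    ext l; rw [norm_mul]; ring
  constructor
  · unfold MemHs; rw [e]; exact Summable.mul_left _ hc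
  · unfold sobNorm sobNormSq
    rw [e, tsum_mul_left, Real.sqrt_mul (sq_nonneg _), Real.sqrt_sq (norm_nonneg _)]

lemma add_aux (a b s : ℝ) (c d : ℤ → ℂ) (hc : MemHs a b s c) (hd : MemHs a b s d) :
    MemHs a b s (fun l => c l + d l) ∧
      sobNorm a b s (fun l => c l + d l) ≤ sobNorm a b s c + sobNorm a b s d := by
  have key : ∀ (c : ℤ → ℂ), (fun l => (Real.sqrt (wt a b s l) * ‖c l‖) ^ 2) =
      fun l => wt a b s l * ‖c l‖ ^ 2 := fun c => by
    ext l; rw [mul_pow, Real.sq_sqrt (wt_pos a b s l).le]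
  have hc' : Summable fun l => wt a b s l * ‖c l‖ ^ 2 := hc
  have hd' : Summable fun l => wt a b s l * ‖d l‖ ^ 2 := hd
  obtain ⟨h1, h2⟩ := cs_aux (fun l => Real.sqrt (wt a b s l) * ‖c l‖)
    (fun l => Real.sqrt (wt a b s l) * ‖d l‖) (fun l => by positivity) (fun l => by positivity)
    (by rw [key]; exact hc) (by rw [key]; exact hd)
  have key2 : (fun l => Real.sqrt (wt a b s l) * ‖c l‖ * (Real.sqrt (wt a b s l) * ‖d l‖)) =
      fun l => wt a b s l * (‖c l‖ * ‖d l‖) := by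
    ext l
    have := Real.mul_self_sqrt (wt_pos a b s l).le
    linear_combination (‖c l‖ * ‖d l‖) * this
  rw [key, key, key2, ← sobNorm_sq, ← sobNorm_sq, ← mul_pow] at h2
  rw [key2] at h1
  have h3 := abs_le_of_sq_le_sq' h2 (mul_nonneg (sobNorm_nonneg _ _ _ _) (sobNorm_nonneg _ _ _ _))
  have hle : ∀ l, wt a b s l * ‖c l + d l‖ ^ 2 ≤
      wt a b s l * ‖c l‖ ^ 2 + wt a b s l * ‖d l‖ ^ 2 + 2 * (wt a b s l * (‖c l‖ * ‖d l‖)) := by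
    intro l
    have h0 := (wt_pos a b s l).le
    calc wt a b s l * ‖c l + d l‖ ^ 2 ≤ wt a b s l * (‖c l‖ + ‖d l‖) ^ 2 := by
          gcongr; exact norm_add_le _ _
      _ = _ := by ring
  have hs := (hc'.add hd').add (h1.mul_left 2)
  have hm : Summable fun l => wt a b s l * ‖c l + d l‖ ^ 2 :=
    Summable.of_nonneg_of_le (fun l => mul_nonneg (wt_pos a b s l).le (sq_nonneg _)) hle hs
  refine ⟨hm, ?_⟩
  apply le_of_sq_le_sq _ (add_nonneg (sobNorm_nonneg _ _ _ _) (sobNorm_nonneg _ _ _ _))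
  rw [sobNorm_sq]
  refine (Summable.tsum_le_tsum hle hm hs).trans ?_
  rw [Summable.tsum_add (hc'.add hd') (h1.mul_left 2), Summable.tsum_add hc' hd', tsum_mul_left,
    ← sobNorm_sq, ← sobNorm_sq]
  nlinarith [h3.2]

lemma sub_mem (a b s : ℝ) (c d : ℤ → ℂ) (hc : MemHs a b s c) (hd : MemHs a b s d) :
    MemHs a b s (fun l => c l - d l) := by
  have := (add_aux a b s c _ hc (smul_aux a b s (-1) d hd).1).1
  convert this using 2
  ring

lemma wt_inv_summable (a b s : ℝ) (hab : a < b) (hs : 1 / 2 < s) :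
    Summable fun l => (wt a b s l)⁻¹ := by
  have h0 := (Real.summable_abs_int_rpow (b := 2 * s) (by linarith)).mul_left
    (((2 * Real.pi / (b - a)) ^ 2) ^ (-s))
  refine Summable.of_norm_bounded_eventually h0 ?_
  have : ∀ᶠ l : ℤ in Filter.cofinite, l ≠ 0 :=
    (Set.finite_singleton (0 : ℤ)).eventually_cofinite_notMem
  filter_upwards [this] with l hl
  have hba : 0 < b - a := by linarith
  have hl' : (0:ℝ) < |(l:ℝ)| := by positivity
  rw [Real.norm_of_nonneg (inv_nonneg.2 (wt_pos a b s l).le)]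
  unfold wt
  rw [← Real.rpow_neg (by positivity)]
  have e : |(l:ℝ)| ^ (-(2 * s)) = (|(l:ℝ)| ^ 2) ^ (-s) := by
    rw [← Real.rpow_natCast, ← Real.rpow_mul hl'.le]; congr 1; push_cast; ring
  rw [e, ← Real.mul_rpow (by positivity) (by positivity)]
  apply Real.rpow_le_rpow_of_nonpos (by positivity)
  · rw [sq_abs]; unfold mu
    have : (2 * Real.pi / (b - a)) ^ 2 * (l:ℝ) ^ 2 = (2 * Real.pi * l / (b - a)) ^ 2 := by ring
    linarith
  · linarith

lemma wt_le (a b s : ℝ) (hs : 0 ≤ s) (l m : ℤ) :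
    wt a b s l ≤ 4 ^ s * (wt a b s m + wt a b s (l - m)) := by
  have hmu : mu a b l = mu a b m + mu a b (l - m) := by
    unfold mu; push_cast; ring
  set x := mu a b m
  set y := mu a b (l - m)
  have e1 : wt a b s m = (1 + x ^ 2) ^ s := rfl
  have e2 : wt a b s (l - m) = (1 + y ^ 2) ^ s := rfl
  have e3 : wt a b s l = (1 + (x + y) ^ 2) ^ s := by unfold wt; rw [hmu]
  have p1 := wt_pos a b s m
  have p2 := wt_pos a b s (l - m)
  rw [e1] at p1; rw [e2] at p2
  rw [e1, e2, e3, mul_add]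
  rcases le_total (x ^ 2) (y ^ 2) with h | h
  · have : (1 + (x + y) ^ 2) ^ s ≤ (4 * (1 + y ^ 2)) ^ s := by
      apply Real.rpow_le_rpow (by positivity) _ hs
      nlinarith [sq_nonneg (x - y)]
    rw [Real.mul_rpow (by norm_num) (by positivity)] at this
    have : 0 ≤ (4:ℝ) ^ s * (1 + x ^ 2) ^ s := by positivity
    linarith
  · have : (1 + (x + y) ^ 2) ^ s ≤ (4 * (1 + x ^ 2)) ^ s := by
      apply Real.rpow_le_rpow (by positivity) _ hs
      nlinarith [sq_nonneg (x - y)]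
    rw [Real.mul_rpow (by norm_num) (by positivity)] at this
    have : 0 ≤ (4:ℝ) ^ s * (1 + y ^ 2) ^ s := by positivity
    linarith

/-- reindexing -/
def shiftEquiv : ℤ × ℤ ≃ ℤ × ℤ where
  toFun q := (q.2, q.1 - q.2)
  invFun q := (q.1 + q.2, q.1)
  left_inv q := by simp
  right_inv q := by simp

set_option maxHeartbeats 1600000 in
lemma conv_aux (a b s : ℝ) (hab : a < b) (hs : 1 / 2 < s) :
    ∃ A : ℝ, 0 ≤ A ∧ ∀ c d, MemHs a b s c → MemHs a b s d →
      (∀ l, Summable fun m => c m * d (l - m)) ∧ MemHs a b s (convC c d) ∧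
      sobNorm a b s (convC c d) ≤ A * (sobNorm a b s c * sobNorm a b s d) := by
  have hK := wt_inv_summable a b s hab hs
  set K := ∑' l, (wt a b s l)⁻¹ with hKdef
  have hK0 : 0 ≤ K := tsum_nonneg fun l => inv_nonneg.2 (wt_pos a b s l).le
  set B : ℝ := 4 ^ s * (K + K) with hB
  have hB0 : 0 ≤ B := by positivity
  refine ⟨Real.sqrt B, Real.sqrt_nonneg _, fun c d hc hd => ?_⟩
  have hc' : Summable fun l => wt a b s l * ‖c l‖ ^ 2 := hc
  have hd' : Summable fun l => wt a b s l * ‖d l‖ ^ 2 := hd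
  have hX : ∀ (c : ℤ → ℂ) l, 0 ≤ wt a b s l * ‖c l‖ ^ 2 :=
    fun c l => mul_nonneg (wt_pos a b s l).le (sq_nonneg _)
  set Z : ℤ × ℤ → ℝ := fun q => (wt a b s q.2 * ‖c q.2‖ ^ 2) *
    (wt a b s (q.1 - q.2) * ‖d (q.1 - q.2)‖ ^ 2) with hZ
  have hprod := hc'.mul_of_nonneg hd' (hX c) (hX d)
  have hZs : Summable Z := (shiftEquiv.summable_iff).2 hprod
  have hZt : ∑' l, ∑' m, Z (l, m) = sobNorm a b s c ^ 2 * sobNorm a b s d ^ 2 := by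
    rw [← hZs.tsum_prod, sobNorm_sq, sobNorm_sq, hc'.tsum_mul_tsum hd' hprod]
    exact shiftEquiv.tsum_eq (fun q : ℤ × ℤ => (wt a b s q.1 * ‖c q.1‖ ^ 2) *
      (wt a b s q.2 * ‖d q.2‖ ^ 2))
  have hZl : ∀ l, Summable fun m => Z (l, m) := fun l => hZs.prod_factor l
  have hZsum : Summable fun l => ∑' m, Z (l, m) := hZs.prod
  have hKl : ∀ l, Summable fun m => (wt a b s (l - m))⁻¹ := fun l =>
    ((Equiv.subLeft l).summable_iff).2 hK
  have hKt : ∀ l, ∑' m, (wt a b s (l - m))⁻¹ = K := fun l =>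
    (Equiv.subLeft l).tsum_eq (fun m => (wt a b s m)⁻¹)
  have hker : ∀ l m, wt a b s l * ((wt a b s m)⁻¹ * (wt a b s (l - m))⁻¹) ≤
      4 ^ s * ((wt a b s m)⁻¹ + (wt a b s (l - m))⁻¹) := by
    intro l m
    have p1 := wt_pos a b s m
    have p2 := wt_pos a b s (l - m)
    calc _ ≤ (4 ^ s * (wt a b s m + wt a b s (l - m))) *
          ((wt a b s m)⁻¹ * (wt a b s (l - m))⁻¹) := by
          gcongr; exact wt_le a b s (by linarith) l m
      _ = _ := by field_simp; ring
  have main : ∀ l, Summable (fun m => ‖c m‖ * ‖d (l - m)‖) ∧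
      wt a b s l * (∑' m, ‖c m‖ * ‖d (l - m)‖) ^ 2 ≤ B * ∑' m, Z (l, m) := by
    intro l
    have ks : Summable fun m => wt a b s l * ((wt a b s m)⁻¹ * (wt a b s (l - m))⁻¹) :=
      Summable.of_nonneg_of_le (fun m => by
        have := wt_pos a b s l
        have := wt_pos a b s m
        have := wt_pos a b s (l - m)
        positivity) (hker l) ((hK.add (hKl l)).mul_left _)
    have ks' : Summable fun m => ((wt a b s m)⁻¹ * (wt a b s (l - m))⁻¹) :=
      (summable_mul_left_iff (wt_pos a b s l).ne').1 ks
    have kt : wt a b s l * ∑' m, ((wt a b s m)⁻¹ * (wt a b s (l - m))⁻¹) ≤ B := by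
      rw [← tsum_mul_left]
      refine (Summable.tsum_le_tsum (hker l) ks ((hK.add (hKl l)).mul_left _)).trans ?_
      rw [tsum_mul_left, Summable.tsum_add hK (hKl l), hKt]
    have e1 : (fun m => (Real.sqrt (wt a b s m * wt a b s (l - m)) * (‖c m‖ * ‖d (l - m)‖)) ^ 2)
        = fun m => Z (l, m) := by
      ext m
      rw [mul_pow, Real.sq_sqrt (mul_pos (wt_pos a b s m) (wt_pos a b s (l - m))).le]
      simp only [hZ]; ring
    have e2 : (fun m => ((Real.sqrt (wt a b s m * wt a b s (l - m)))⁻¹) ^ 2)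
        = fun m => ((wt a b s m)⁻¹ * (wt a b s (l - m))⁻¹) := by
      ext m
      rw [inv_pow, Real.sq_sqrt (mul_pos (wt_pos a b s m) (wt_pos a b s (l - m))).le, mul_inv]
    have e3 : (fun m => Real.sqrt (wt a b s m * wt a b s (l - m)) * (‖c m‖ * ‖d (l - m)‖) *
        (Real.sqrt (wt a b s m * wt a b s (l - m)))⁻¹) = fun m => ‖c m‖ * ‖d (l - m)‖ := by
      ext m
      have := Real.sqrt_pos.2 (mul_pos (wt_pos a b s m) (wt_pos a b s (l - m)))
      field_simp
    obtain ⟨h1, h2⟩ := cs_aux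
      (fun m => Real.sqrt (wt a b s m * wt a b s (l - m)) * (‖c m‖ * ‖d (l - m)‖))
      (fun m => (Real.sqrt (wt a b s m * wt a b s (l - m)))⁻¹)
      (fun m => by positivity) (fun m => by positivity)
      (by rw [e1]; exact hZl l) (by rw [e2]; exact ks')
    rw [e3] at h1
    rw [e1, e2, e3] at h2
    refine ⟨h1, ?_⟩
    have hz0 : 0 ≤ ∑' m, Z (l, m) := tsum_nonneg fun m => mul_nonneg (hX c _) (hX d _)
    have hw := (wt_pos a b s l).le
    calc _ ≤ wt a b s l * ((∑' m, Z (l, m)) *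
            ∑' m, ((wt a b s m)⁻¹ * (wt a b s (l - m))⁻¹)) := by gcongr
      _ = (wt a b s l * ∑' m, ((wt a b s m)⁻¹ * (wt a b s (l - m))⁻¹)) * ∑' m, Z (l, m) := by ring
      _ ≤ _ := by gcongr
  have hsn : ∀ l, Summable fun m => ‖c m * d (l - m)‖ := fun l => by
    simpa only [norm_mul] using (main l).1
  have hle : ∀ l, wt a b s l * ‖convC c d l‖ ^ 2 ≤ B * ∑' m, Z (l, m) := fun l => by
    have hw := (wt_pos a b s l).le
    refine le_trans ?_ (main l).2
    gcongr
    refine (norm_tsum_le_tsum_norm (hsn l)).trans (le_of_eq ?_)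
    simp only [norm_mul]
  have hm : Summable fun l => wt a b s l * ‖convC c d l‖ ^ 2 :=
    Summable.of_nonneg_of_le (hX _) hle (hZsum.mul_left B)
  refine ⟨fun l => (hsn l).of_norm, hm, ?_⟩
  apply le_of_sq_le_sq _ (mul_nonneg (Real.sqrt_nonneg _)
    (mul_nonneg (sobNorm_nonneg _ _ _ _) (sobNorm_nonneg _ _ _ _)))
  rw [sobNorm_sq, mul_pow, Real.sq_sqrt hB0, mul_pow, ← hZt, ← tsum_mul_left]
  exact Summable.tsum_le_tsum hle hm (hZsum.mul_left B)

lemma one_mem (a b s : ℝ) : MemHs a b s oneC := by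
  apply summable_of_ne_finset_zero (s := {0})
  intro l hl
  have : l ≠ 0 := by simpa using hl
  simp [oneC, this]

lemma pow_aux (a b s : ℝ) (hab : a < b) (hs : 1 / 2 < s) (R : ℝ) (hR : 0 < R) (n : ℕ) :
    ∃ P Q : ℝ, 0 ≤ P ∧ 0 ≤ Q ∧ ∀ c d, MemHs a b s c → MemHs a b s d →
      sobNorm a b s c ≤ R → sobNorm a b s d ≤ R →
      MemHs a b s (powC c n) ∧ sobNorm a b s (powC c n) ≤ P ∧
      sobNorm a b s (fun l => powC c n l - powC d n l) ≤
        Q * sobNorm a b s (fun l => c l - d l) := by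
  obtain ⟨A, hA, hconv⟩ := conv_aux a b s hab hs
  induction n with
  | zero =>
    refine ⟨sobNorm a b s oneC, 0, sobNorm_nonneg _ _ _ _, le_rfl, fun c d _ _ _ _ =>
      ⟨one_mem a b s, le_rfl, ?_⟩⟩
    simp [powC, sobNorm, sobNormSq]
  | succ n ih =>
    obtain ⟨P, Q, hP, hQ, ih⟩ := ih
    refine ⟨A * (R * P), A * (R * Q) + A * P, by positivity, by positivity,
      fun c d hc hd hcR hdR => ?_⟩
    obtain ⟨mc, nc, ncd⟩ := ih c d hc hd hcR hdR
    obtain ⟨md, nd, -⟩ := ih d c hd hc hdR hcR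
    obtain ⟨s1, m1, n1⟩ := hconv c _ hc mc
    obtain ⟨s2, m2, n2⟩ := hconv d _ hd md
    have hsub := sub_mem a b s _ _ mc md
    have hsub' := sub_mem a b s _ _ hc hd
    obtain ⟨s3, m3, n3⟩ := hconv c _ hc hsub
    obtain ⟨s4, m4, n4⟩ := hconv _ _ hsub' md
    have g0 := sobNorm_nonneg a b s (fun l => c l - d l)
    have g1 := sobNorm_nonneg a b s c
    have g2 := sobNorm_nonneg a b s (powC c n)
    have g3 := sobNorm_nonneg a b s (powC d n)
    have g4 := sobNorm_nonneg a b s (fun l => powC c n l - powC d n l)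
    refine ⟨m1, ?_, ?_⟩
    · refine n1.trans ?_
      gcongr
    · have e : (fun l => powC c (n + 1) l - powC d (n + 1) l) = fun l =>
          convC c (fun l => powC c n l - powC d n l) l +
          convC (fun l => c l - d l) (powC d n) l := by
        ext l
        simp only [powC, convC]
        rw [← Summable.tsum_sub (s1 l) (s2 l), ← Summable.tsum_add (s3 l) (s4 l)]
        congr 1; ext m; ring
      rw [e]
      refine (add_aux a b s _ _ m3 m4).2.trans ?_
      calc _ ≤ A * (R * (Q * sobNorm a b s (fun l => c l - d l))) +
            A * (sobNorm a b s (fun l => c l - d l) * P) := by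
            refine add_le_add (n3.trans ?_) (n4.trans ?_) <;> gcongr
        _ = _ := by ring

lemma conj_aux (a b s : ℝ) (c : ℤ → ℂ) (hc : MemHs a b s c) :
    MemHs a b s (conjC c) ∧ sobNorm a b s (conjC c) = sobNorm a b s c := by
  have e : (fun l => (1 + mu a b l ^ 2) ^ s * ‖conjC c l‖ ^ 2) =
      (fun l => (1 + mu a b l ^ 2) ^ s * ‖c l‖ ^ 2) ∘ (Equiv.neg ℤ) := by
    ext l
    have : mu a b (-l) ^ 2 = mu a b l ^ 2 := by unfold mu; push_cast; ring
    simp [conjC, this]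
  constructor
  · unfold MemHs; rw [e]; exact (Equiv.summable_iff _).2 hc
  · unfold sobNorm sobNormSq; rw [e]
    congr 1
    exact (Equiv.neg ℤ).tsum_eq (fun l => (1 + mu a b l ^ 2) ^ s * ‖c l‖ ^ 2)

lemma re_aux (a b s : ℝ) (c : ℤ → ℂ) (hc : MemHs a b s c) :
    MemHs a b s (reC c) ∧ sobNorm a b s (reC c) ≤ sobNorm a b s c := by
  obtain ⟨h1, h2⟩ := conj_aux a b s c hc
  obtain ⟨h3, h4⟩ := add_aux a b s _ _ hc h1
  obtain ⟨h5, h6⟩ := smul_aux a b s (1 / 2) _ h3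
  have e : reC c = fun l => (1 / 2 : ℂ) * (c l + conjC c l) := by
    ext l; simp only [reC]; ring
  rw [e]
  refine ⟨h5, ?_⟩
  rw [h6]
  norm_num
  linarith

lemma re_sub (c d : ℤ → ℂ) : (fun l => reC c l - reC d l) = reC (fun l => c l - d l) := by
  ext l; simp only [reC, conjC, map_sub]; ring

lemma expJ_norm (a b t : ℝ) (c : ℤ → ℂ) (l : ℤ) : ‖expJ a b t c l‖ = ‖c l‖ := by
  have e : Complex.I * (t : ℂ) * (zeta a b l : ℂ) = ((t * zeta a b l : ℝ) : ℂ) * Complex.I := by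
    push_cast; ring
  simp only [expJ]
  rw [norm_mul, e, Complex.norm_exp_ofReal_mul_I, one_mul]

lemma expJ_aux (a b s t : ℝ) (c : ℤ → ℂ) (hc : MemHs a b s c) :
    MemHs a b s (expJ a b t c) ∧ sobNorm a b s (expJ a b t c) ≤ sobNorm a b s c :=
  mono_aux a b s _ _ (fun l => (expJ_norm a b t c l).le) hc

lemma expJ_sub (a b t : ℝ) (c d : ℤ → ℂ) :
    (fun l => expJ a b t c l - expJ a b t d l) = expJ a b t (fun l => c l - d l) := by
  ext l; simp only [expJ]; ring

lemma one_le_zeta (a b : ℝ) (l : ℤ) : 1 ≤ zeta a b l := by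
  unfold zeta
  apply Real.le_sqrt_of_sq_le
  nlinarith [sq_nonneg (mu a b l)]

lemma F_aux (a b s : ℝ) (hab : a < b) (hs : 1 / 2 < s) (R : ℝ) (hR : 0 < R) (p : ℕ) :
    ∃ Q : ℝ, 0 ≤ Q ∧ ∀ c d, MemHs a b s c → MemHs a b s d →
      sobNorm a b s c ≤ R → sobNorm a b s d ≤ R →
      MemHs a b s (fun l => Fop a b p c l - Fop a b p d l) ∧
      sobNorm a b s (fun l => Fop a b p c l - Fop a b p d l) ≤
        Q * sobNorm a b s (fun l => c l - d l) := by
  obtain ⟨P, Q, hP, hQ, h⟩ := pow_aux a b s hab hs R hR (p + 1)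
  refine ⟨Q, hQ, fun c d hc hd hcR hdR => ?_⟩
  obtain ⟨c1, c2⟩ := re_aux a b s c hc
  obtain ⟨d1, d2⟩ := re_aux a b s d hd
  obtain ⟨m1, -, n1⟩ := h _ _ c1 d1 (c2.trans hcR) (d2.trans hdR)
  obtain ⟨m2, -, -⟩ := h _ _ d1 c1 (d2.trans hdR) (c2.trans hcR)
  have hm := sub_mem a b s _ _ m1 m2
  obtain ⟨h1, h2⟩ := mono_aux a b s (fun l => Fop a b p c l - Fop a b p d l) _ (fun l => by
    have hz := one_le_zeta a b l
    have e : Fop a b p c l - Fop a b p d l =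
        Complex.I * ((powC (reC c) (p + 1) l - powC (reC d) (p + 1) l) / (zeta a b l : ℂ)) := by
      simp only [Fop, opJinv, Gop]; ring
    rw [e, norm_mul, Complex.norm_I, one_mul, norm_div, Complex.norm_real,
      Real.norm_of_nonneg (by linarith)]
    exact div_le_self (norm_nonneg _) hz) hm
  refine ⟨h1, h2.trans (n1.trans ?_)⟩
  rw [re_sub]
  have := (re_aux a b s _ (sub_mem a b s _ _ hc hd)).2
  gcongr


/-- **Lemma 3.2.** Stability of the Strang splitting flow:
for `φ₀, η₀ ∈ B_R^s`, `‖S_τ(φ₀) − S_τ(η₀)‖_s ≤ (1 + Lε^pτ)‖φ₀ − η₀‖_s`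
with `L` depending only on `R` (and `s`, `p`, `Ω`). -/
theorem strang_stability (a b : ℝ) (hab : a < b) (p : ℕ) (hp : 1 ≤ p)
    (s R : ℝ) (hs : 1 / 2 < s) (hR : 0 < R) :
    ∃ L > 0, ∀ (φ₀ η₀ : ℤ → ℂ),
      MemHs a b s φ₀ → sobNorm a b s φ₀ ≤ R →
      MemHs a b s η₀ → sobNorm a b s η₀ ≤ R →
      ∀ (τ ε : ℝ), 0 < τ → 0 < ε → ε ≤ 1 →
        sobNorm a b s (fun l => strang a b p ε τ φ₀ l - strang a b p ε τ η₀ l) ≤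
          (1 + L * ε ^ p * τ) * sobNorm a b s (fun l => φ₀ l - η₀ l) := by
  obtain ⟨Q, hQ, hF⟩ := F_aux a b s hab hs R hR p
  refine ⟨Q + 1, by positivity, fun φ η hφ hφR hη hηR τ ε hτ hε _ => ?_⟩
  obtain ⟨c1, c2⟩ := expJ_aux a b s (τ / 2) φ hφ
  obtain ⟨d1, d2⟩ := expJ_aux a b s (τ / 2) η hη
  obtain ⟨f1, f2⟩ := hF _ _ c1 d1 (c2.trans hφR) (d2.trans hηR)
  have hm := sub_mem a b s _ _ c1 d1
  have hd := (expJ_aux a b s (τ / 2) _ (sub_mem a b s _ _ hφ hη)).2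
  rw [← expJ_sub] at hd
  obtain ⟨k1, k2⟩ := smul_aux a b s ((ε ^ p * τ : ℝ) : ℂ) _ f1
  obtain ⟨a1, a2⟩ := add_aux a b s _ _ hm k1
  have e : (fun l => strang a b p ε τ φ l - strang a b p ε τ η l) = expJ a b (τ / 2) (fun l =>
      (expJ a b (τ / 2) φ l - expJ a b (τ / 2) η l) + ((ε ^ p * τ : ℝ) : ℂ) *
      (Fop a b p (expJ a b (τ / 2) φ) l - Fop a b p (expJ a b (τ / 2) η) l)) := by
    unfold strang
    rw [expJ_sub]
    congr 1; ext l
    simp only [flowV, Complex.real_smul]; ring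
  rw [e]
  have hk : 0 ≤ ε ^ p * τ := by positivity
  rw [Complex.norm_real, Real.norm_of_nonneg hk] at k2
  rw [k2] at a2
  refine ((expJ_aux a b s (τ / 2) _ a1).2.trans a2).trans ?_
  have g0 := sobNorm_nonneg a b s (fun l => φ l - η l)
  calc _ ≤ sobNorm a b s (fun l => φ l - η l) +
        ε ^ p * τ * (Q * sobNorm a b s (fun l => φ l - η l)) := by
        refine add_le_add hd ?_
        gcongr
        refine f2.trans ?_
        gcongr
    _ ≤ _ := by nlinarith [mul_nonneg hk g0]

end NKGE
end
end

section
/- Let s ≥ 1, ε ∈ (0,1] and 0 < τ ≤ 1/ε^p. Let ψ(t) = S_{e,t}(ψ₀) denote the exact solution of the relativistic NLSE with initial data ψ₀, and assume ψ ∈ L^∞([0,T_ε]; H^{s+1}(Ω)). Then there exists a constant M₀ > 0, depending on ‖ψ‖_{L^∞([0,T_ε]; H^{s+1})}, such that for every t_n = nτ with t_n + τ ≤ T_ε the local error of the Strang splitting is bounded by ‖S_τ(ψ(t_n)) − S_{e,τ}(ψ(t_n))‖_s ≤ M₀ ε^p τ³. -/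
/- Periodic functions on Ω = (a,b) are represented by their Fourier coefficient
sequences `c : ℤ → ℂ`, i.e. `z(x) = ∑_{l∈ℤ} c l * exp(i μ_l (x−a))` with
`μ_l = 2πl/(b−a)`.  All operators are expressed on the Fourier side:
`⟨∇⟩`, `⟨∇⟩⁻¹`, `e^{it⟨∇⟩}` act diagonally, complex conjugation of the function
corresponds to `l ↦ conj (c (−l))`, and the pointwise product of two functions
corresponds to the convolution of their coefficient sequences. -/

noncomputable section

namespace NKGE

lemma zeta_pos (a b : ℝ) (l : ℤ) : 0 < zeta a b l := lt_of_lt_of_le one_pos (one_le_zeta a b l)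

lemma zeta_neg (a b : ℝ) (l : ℤ) : zeta a b (-l) = zeta a b l := by
  unfold zeta mu
  congr 2
  push_cast
  ring

lemma zeta_sq (a b : ℝ) (l : ℤ) : zeta a b l ^ 2 = 1 + mu a b l ^ 2 := by
  unfold zeta
  rw [Real.sq_sqrt]
  positivity

lemma zeta_rpow_sq (a b σ : ℝ) (l : ℤ) : (zeta a b l ^ σ) ^ 2 = (1 + mu a b l ^ 2) ^ σ := by
  rw [← zeta_sq, ← Real.rpow_natCast, ← Real.rpow_mul (zeta_pos a b l).le, mul_comm,
    Real.rpow_mul (zeta_pos a b l).le, Real.rpow_natCast]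

lemma zeta_add_le (a b : ℝ) (m n : ℤ) : zeta a b (m + n) ≤ zeta a b m + zeta a b n := by
  have h1 := zeta_sq a b m
  have h2 := zeta_sq a b n
  have p1 := zeta_pos a b m
  have p2 := zeta_pos a b n
  have h3 : mu a b (m + n) = mu a b m + mu a b n := by
    unfold mu; push_cast; ring
  have h4 : mu a b m * mu a b n ≤ zeta a b m * zeta a b n := by
    apply le_of_sq_le_sq _ (by positivity)
    rw [mul_pow, mul_pow, h1, h2]
    nlinarith [sq_nonneg (mu a b m), sq_nonneg (mu a b n)]
  conv_lhs => unfold zeta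
  rw [Real.sqrt_le_left (by positivity), h3]
  nlinarith

lemma zeta_le_split (a b : ℝ) (l m : ℤ) : zeta a b l ≤ zeta a b m + zeta a b (l - m) := by
  have := zeta_add_le a b m (l - m)
  rwa [add_sub_cancel] at this

lemma zeta_peetre (a b σ : ℝ) (hσ : 0 ≤ σ) (l m : ℤ) :
    zeta a b l ^ σ ≤ 2 ^ σ * (zeta a b m ^ σ * zeta a b (l - m) ^ σ) := by
  have h := zeta_le_split a b l m
  have p0 := zeta_pos a b l
  have p1 := one_le_zeta a b m
  have p2 := one_le_zeta a b (l - m)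
  rw [← Real.mul_rpow (by linarith) (by linarith), ← Real.mul_rpow (by norm_num) (by positivity)]
  apply Real.rpow_le_rpow p0.le _ hσ
  nlinarith

lemma zeta_alg (a b σ : ℝ) (hσ : 0 ≤ σ) (l m : ℤ) :
    zeta a b l ^ σ ≤ 2 ^ σ * (zeta a b m ^ σ + zeta a b (l - m) ^ σ) := by
  have h := zeta_le_split a b l m
  have p0 := zeta_pos a b l
  have p1 := zeta_pos a b m
  have p2 := zeta_pos a b (l - m)
  have q1 : 0 < zeta a b m ^ σ := by positivity
  have q2 : 0 < zeta a b (l - m) ^ σ := by positivity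
  have q3 : (0:ℝ) < 2 ^ σ := by positivity
  rcases le_total (zeta a b m) (zeta a b (l - m)) with h' | h'
  · calc zeta a b l ^ σ ≤ (2 * zeta a b (l - m)) ^ σ :=
        Real.rpow_le_rpow p0.le (by linarith) hσ
      _ = 2 ^ σ * zeta a b (l - m) ^ σ := Real.mul_rpow (by norm_num) p2.le
      _ ≤ _ := by gcongr; linarith
  · calc zeta a b l ^ σ ≤ (2 * zeta a b m) ^ σ :=
        Real.rpow_le_rpow p0.le (by linarith) hσ
      _ = 2 ^ σ * zeta a b m ^ σ := Real.mul_rpow (by norm_num) p1.le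
      _ ≤ _ := by gcongr; linarith

/-- `‖c‖_σ ≤ B`. -/
def Hb (a b σ : ℝ) (c : ℤ → ℂ) (B : ℝ) : Prop :=
  0 ≤ B ∧ ∀ S : Finset ℤ, ∑ l ∈ S, (zeta a b l ^ σ * ‖c l‖) ^ 2 ≤ B ^ 2

lemma Hb.of_mem {a b σ K : ℝ} {c : ℤ → ℂ} (hK : 0 ≤ K) (h : MemHs a b σ c)
    (hn : sobNorm a b σ c ≤ K) : Hb a b σ c K := by
  refine ⟨hK, fun S => ?_⟩
  unfold sobNorm at hn
  rw [Real.sqrt_le_left hK] at hn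
  refine le_trans ?_ hn
  unfold sobNormSq
  simp only [mul_pow, zeta_rpow_sq]
  exact h.sum_le_tsum S (fun l _ => by positivity)

lemma Hb.sobNorm_le {a b σ K : ℝ} {c : ℤ → ℂ} (h : Hb a b σ c K) : sobNorm a b σ c ≤ K := by
  unfold sobNorm
  rw [Real.sqrt_le_left h.1]
  unfold sobNormSq
  apply Real.tsum_le_of_sum_le (fun l => by positivity)
  intro S
  have := h.2 S
  simpa only [mul_pow, zeta_rpow_sq] using this

lemma l2_add {x y z : ℤ → ℝ} {A B : ℝ} {S : Finset ℤ} (hA : 0 ≤ A) (hB : 0 ≤ B)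
    (hz : ∀ l, 0 ≤ z l)
    (hx : ∑ l ∈ S, x l ^ 2 ≤ A ^ 2) (hy : ∑ l ∈ S, y l ^ 2 ≤ B ^ 2)
    (h : ∀ l, z l ≤ x l + y l) : ∑ l ∈ S, z l ^ 2 ≤ (A + B) ^ 2 := by
  have h1 : ∑ l ∈ S, x l * y l ≤ A * B := by
    apply le_of_sq_le_sq _ (by positivity)
    refine (Finset.sum_mul_sq_le_sq_mul_sq S x y).trans ?_
    rw [mul_pow]
    exact mul_le_mul hx hy (Finset.sum_nonneg fun _ _ => by positivity) (by positivity)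
  calc ∑ l ∈ S, z l ^ 2 ≤ ∑ l ∈ S, (x l + y l) ^ 2 :=
        Finset.sum_le_sum fun l _ => pow_le_pow_left₀ (hz l) (h l) 2
    _ = ∑ l ∈ S, x l ^ 2 + 2 * ∑ l ∈ S, x l * y l + ∑ l ∈ S, y l ^ 2 := by
        rw [Finset.mul_sum, ← Finset.sum_add_distrib, ← Finset.sum_add_distrib]
        exact Finset.sum_congr rfl fun l _ => by ring
    _ ≤ _ := by nlinarith

lemma wn_nonneg (a b σ : ℝ) (c : ℤ → ℂ) (l : ℤ) : 0 ≤ zeta a b l ^ σ * ‖c l‖ := by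
  have := zeta_pos a b l
  positivity

lemma Hb.dom2 {a b σ σ' ρ A B : ℝ} {x y z : ℤ → ℂ} (hx : Hb a b σ x A) (hy : Hb a b σ' y B)
    (h : ∀ l, zeta a b l ^ ρ * ‖z l‖ ≤ zeta a b l ^ σ * ‖x l‖ + zeta a b l ^ σ' * ‖y l‖) :
    Hb a b ρ z (A + B) :=
  ⟨add_nonneg hx.1 hy.1, fun S => l2_add hx.1 hy.1 (wn_nonneg a b ρ z) (hx.2 S) (hy.2 S) h⟩

lemma Hb.dom {a b σ ρ A k : ℝ} {x z : ℤ → ℂ} (hk : 0 ≤ k) (hx : Hb a b σ x A)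
    (h : ∀ l, zeta a b l ^ ρ * ‖z l‖ ≤ k * (zeta a b l ^ σ * ‖x l‖)) :
    Hb a b ρ z (k * A) := by
  refine ⟨mul_nonneg hk hx.1, fun S => ?_⟩
  calc _ ≤ ∑ l ∈ S, (k * (zeta a b l ^ σ * ‖x l‖)) ^ 2 :=
        Finset.sum_le_sum fun l _ => pow_le_pow_left₀ (wn_nonneg a b ρ z l) (h l) 2
    _ = k ^ 2 * ∑ l ∈ S, (zeta a b l ^ σ * ‖x l‖) ^ 2 := by
        rw [Finset.mul_sum]; exact Finset.sum_congr rfl fun l _ => by ring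
    _ ≤ _ := by rw [mul_pow]; exact mul_le_mul_of_nonneg_left (hx.2 S) (by positivity)

lemma Hb.add {a b σ A B : ℝ} {x y : ℤ → ℂ} (hx : Hb a b σ x A) (hy : Hb a b σ y B) :
    Hb a b σ (fun l => x l + y l) (A + B) :=
  hx.dom2 hy fun l => by
    have := zeta_pos a b l
    rw [← mul_add]; gcongr; exact norm_add_le _ _

lemma Hb.smul {a b σ A : ℝ} {x : ℤ → ℂ} (hx : Hb a b σ x A) (k : ℂ) :
    Hb a b σ (fun l => k * x l) (‖k‖ * A) :=
  hx.dom (norm_nonneg k) fun l => by rw [norm_mul]; apply le_of_eq; ring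

lemma Hb.sub {a b σ A B : ℝ} {x y : ℤ → ℂ} (hx : Hb a b σ x A) (hy : Hb a b σ y B) :
    Hb a b σ (fun l => x l - y l) (A + B) :=
  hx.dom2 hy fun l => by
    have := zeta_pos a b l
    rw [← mul_add]; gcongr; exact norm_sub_le _ _

lemma Hb.le {a b σ A B : ℝ} {x : ℤ → ℂ} (hx : Hb a b σ x A) (h : A ≤ B) : Hb a b σ x B :=
  ⟨hx.1.trans h, fun S => (hx.2 S).trans (pow_le_pow_left₀ hx.1 h 2)⟩

lemma Hb.mono {a b σ σ' A : ℝ} {x : ℤ → ℂ} (hx : Hb a b σ x A) (h : σ' ≤ σ) : Hb a b σ' x A := by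
  have := hx.dom (ρ := σ') (z := x) (k := 1) zero_le_one fun l => by
    rw [one_mul]
    gcongr
    exact one_le_zeta a b l
  simpa using this

/-- same pointwise norms. -/
lemma Hb.congr {a b σ σ' A : ℝ} {x y : ℤ → ℂ} (hx : Hb a b σ x A)
    (h : ∀ l, zeta a b l ^ σ' * ‖y l‖ = zeta a b l ^ σ * ‖x l‖) : Hb a b σ' y A := by
  refine ⟨hx.1, fun S => ?_⟩
  simp only [h]
  exact hx.2 S

lemma Hb.neg {a b σ A : ℝ} {x : ℤ → ℂ} (hx : Hb a b σ x A) :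
    Hb a b σ (fun l => - x l) A := hx.congr fun l => by rw [norm_neg]

lemma Hb.conj {a b σ A : ℝ} {x : ℤ → ℂ} (hx : Hb a b σ x A) :
    Hb a b σ (conjC x) A := by
  refine ⟨hx.1, fun S => ?_⟩
  have := hx.2 (S.map (Equiv.neg ℤ).toEmbedding)
  rw [Finset.sum_map] at this
  simpa [conjC, zeta_neg] using this

lemma Hb.re {a b σ A : ℝ} {x : ℤ → ℂ} (hx : Hb a b σ x A) : Hb a b σ (reC x) A := by
  have := (hx.add hx.conj).smul (1 / 2)
  have h2 : ‖(1 / 2 : ℂ)‖ * (A + A) = A := by norm_num; ring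
  rw [h2] at this
  exact this.congr fun l => by unfold reC; congr 2; ring

lemma zeta_rpow_succ (a b σ : ℝ) (l : ℤ) : zeta a b l ^ (σ + 1) = zeta a b l ^ σ * zeta a b l := by
  rw [Real.rpow_add (zeta_pos a b l), Real.rpow_one]

lemma Hb.J {a b σ A : ℝ} {x : ℤ → ℂ} (hx : Hb a b (σ + 1) x A) :
    Hb a b σ (fun l => (zeta a b l : ℂ) * x l) A :=
  hx.congr fun l => by
    rw [zeta_rpow_succ, norm_mul, Complex.norm_real, Real.norm_of_nonneg (zeta_pos a b l).le]
    ring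

lemma Hb.one (a b σ : ℝ) : Hb a b σ oneC 1 := by
  refine ⟨zero_le_one, fun S => ?_⟩
  have h : ∀ l, (zeta a b l ^ σ * ‖oneC l‖) ^ 2 = if l = 0 then 1 else 0 := by
    intro l
    unfold oneC
    split_ifs with h
    · subst h; simp [zeta, mu]
    · simp
  simp only [h]
  rw [Finset.sum_ite_eq']
  split_ifs <;> norm_num

lemma summable_zeta (a b : ℝ) (hab : a < b) : Summable fun l : ℤ => (zeta a b l ^ (-1:ℝ)) ^ 2 := by
  have h := (Real.summable_one_div_int_pow (p := 2)).2 one_lt_two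
  have hba : 0 < b - a := sub_pos.2 hab
  have h2 := h.mul_left (((2 * Real.pi) / (b - a)) ^ 2)⁻¹
  refine Summable.of_norm_bounded_eventually h2 ?_
  have : ∀ᶠ l : ℤ in Filter.cofinite, l ≠ 0 :=
    Filter.eventually_cofinite_ne 0
  filter_upwards [this] with l hl
  rw [Real.norm_of_nonneg (by positivity), Real.rpow_neg_one, inv_pow, zeta_sq, one_div, ← mul_inv]
  have hl' : (0:ℝ) < (l:ℝ) ^ 2 := by positivity
  have hpi := Real.pi_pos
  apply inv_anti₀ (by positivity)
  have : mu a b l ^ 2 = (2 * Real.pi / (b - a)) ^ 2 * (l:ℝ) ^ 2 := by unfold mu; ring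
  rw [this]; linarith

/-- embedding constant -/
def Zc (a b : ℝ) : ℝ := Real.sqrt (∑' l : ℤ, (zeta a b l ^ (-1:ℝ)) ^ 2)

lemma Zc_nonneg (a b : ℝ) : 0 ≤ Zc a b := Real.sqrt_nonneg _

lemma Hb.l1 {a b σ A : ℝ} {x : ℤ → ℂ} (hab : a < b) (hx : Hb a b (σ + 1) x A) (S : Finset ℤ) :
    ∑ l ∈ S, zeta a b l ^ σ * ‖x l‖ ≤ Zc a b * A := by
  have hZ := Zc_nonneg a b
  have hA := hx.1
  have e : ∀ l, zeta a b l ^ σ * ‖x l‖ = zeta a b l ^ (-1:ℝ) * (zeta a b l ^ (σ + 1) * ‖x l‖) := by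
    intro l
    rw [← mul_assoc, ← Real.rpow_add (zeta_pos a b l)]
    congr 2; ring
  apply le_of_sq_le_sq _ (by positivity)
  simp only [e]
  refine (Finset.sum_mul_sq_le_sq_mul_sq S _ _).trans ?_
  rw [mul_pow]
  refine mul_le_mul ?_ (hx.2 S) (Finset.sum_nonneg fun _ _ => by positivity) (by positivity)
  unfold Zc
  rw [Real.sq_sqrt (tsum_nonneg fun l => by positivity)]
  exact (summable_zeta a b hab).sum_le_tsum S fun l _ => by positivity

lemma young {x y : ℤ → ℝ} {M A : ℝ} (hx : ∀ l, 0 ≤ x l) (hy : ∀ l, 0 ≤ y l) (hA : 0 ≤ A)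
    (h1 : ∀ S : Finset ℤ, ∑ l ∈ S, x l ≤ M) (h2 : ∀ S : Finset ℤ, ∑ l ∈ S, y l ^ 2 ≤ A ^ 2) :
    (∀ l, Summable fun m => x m * y (l - m)) ∧
      ∀ S : Finset ℤ, ∑ l ∈ S, (∑' m, x m * y (l - m)) ^ 2 ≤ (M * A) ^ 2 := by
  have sx : Summable x := summable_of_sum_le hx h1
  have by' : ∀ l, y l ≤ A := by
    intro l
    have := h2 {l}
    rw [Finset.sum_singleton] at this
    exact le_of_sq_le_sq this hA
  have sm : ∀ l, Summable fun m => x m * y (l - m) := fun l =>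
    Summable.of_nonneg_of_le (fun m => mul_nonneg (hx m) (hy _))
      (fun m => mul_le_mul_of_nonneg_left (by' _) (hx m)) (sx.mul_right A)
  have hM : 0 ≤ M := by simpa using h1 ∅
  refine ⟨sm, fun S => ?_⟩
  have key : ∀ F : Finset ℤ, ∑ l ∈ S, (∑ m ∈ F, x m * y (l - m)) ^ 2 ≤ ((∑ m ∈ F, x m) * A) ^ 2 := by
    intro F
    induction F using Finset.induction_on with
    | empty => simp
    | insert i F hi ih =>
      rw [Finset.sum_insert hi, add_mul]
      refine l2_add (x := fun l => x i * y (l - i)) (y := fun l => ∑ m ∈ F, x m * y (l - m))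
        (mul_nonneg (hx i) hA) (mul_nonneg (Finset.sum_nonneg fun m _ => hx m) hA)
        (fun l => Finset.sum_nonneg fun m _ => mul_nonneg (hx m) (hy _)) ?_ ih
        (fun l => by rw [Finset.sum_insert hi])
      simp only [mul_pow]
      rw [← Finset.mul_sum]
      refine mul_le_mul_of_nonneg_left ?_ (by positivity)
      have := h2 (S.map (Equiv.subRight i).toEmbedding)
      rw [Finset.sum_map] at this
      simpa using this
  have lim : Filter.Tendsto (fun F : Finset ℤ => ∑ l ∈ S, (∑ m ∈ F, x m * y (l - m)) ^ 2)
      Filter.atTop (nhds (∑ l ∈ S, (∑' m, x m * y (l - m)) ^ 2)) :=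
    tendsto_finsetSum S fun l _ => ((sm l).hasSum).pow 2
  refine le_of_tendsto lim (Filter.Eventually.of_forall fun F => (key F).trans ?_)
  have : 0 ≤ ∑ m ∈ F, x m := Finset.sum_nonneg fun m _ => hx m
  gcongr
  exact h1 F

lemma convC_comm (c d : ℤ → ℂ) : convC c d = convC d c := by
  funext l
  unfold convC
  rw [← (Equiv.subLeft l).tsum_eq]
  simp [mul_comm]

/-- summable norms -/
lemma Hb.summable {a b σ A : ℝ} {x : ℤ → ℂ} (hab : a < b) (hσ : 0 ≤ σ) (hx : Hb a b (σ + 1) x A) :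
    Summable fun l => ‖x l‖ := by
  have h0 : Hb a b (0 + 1) x A := hx.mono (by linarith)
  have := fun S => h0.l1 hab S
  simp only [Real.rpow_zero, one_mul] at this
  exact summable_of_sum_le (fun _ => norm_nonneg _) this

lemma summable_conv {c d : ℤ → ℂ} (hc : Summable fun l => ‖c l‖) (hd : Summable fun l => ‖d l‖)
    (l : ℤ) : HasSum (fun m => c m * d (l - m)) (convC c d l) := by
  have hb : ∃ D, ∀ m, ‖d m‖ ≤ D :=
    ⟨∑' m, ‖d m‖, fun m => hd.le_tsum m fun _ _ => norm_nonneg _⟩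
  obtain ⟨D, hD⟩ := hb
  refine Summable.hasSum (Summable.of_norm_bounded (hc.mul_right D) fun m => ?_)
  rw [norm_mul]
  exact mul_le_mul_of_nonneg_left (hD _) (norm_nonneg _)

lemma conv_peetre {a b σ A B : ℝ} {c d : ℤ → ℂ} (hab : a < b) (hσ : 0 ≤ σ)
    (hc : Hb a b σ c A) (hd : Hb a b (σ + 1) d B) :
    Hb a b σ (convC d c) (2 ^ σ * Zc a b * B * A) := by
  have hZ := Zc_nonneg a b
  have hA := hc.1
  have hB := hd.1
  obtain ⟨h1, h2⟩ := young (wn_nonneg a b σ d) (wn_nonneg a b σ c) hA (hd.l1 hab) hc.2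
  refine ⟨by positivity, fun S => ?_⟩
  have key : ∀ l, zeta a b l ^ σ * ‖convC d c l‖ ≤
      2 ^ σ * ∑' m, (zeta a b m ^ σ * ‖d m‖) * (zeta a b (l - m) ^ σ * ‖c (l - m)‖) := by
    intro l
    have hb : ∀ m, zeta a b l ^ σ * ‖d m * c (l - m)‖ ≤
        2 ^ σ * ((zeta a b m ^ σ * ‖d m‖) * (zeta a b (l - m) ^ σ * ‖c (l - m)‖)) := by
      intro m
      rw [norm_mul]
      calc _ ≤ (2 ^ σ * (zeta a b m ^ σ * zeta a b (l - m) ^ σ)) * (‖d m‖ * ‖c (l - m)‖) := by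
            gcongr; exact zeta_peetre a b σ hσ l m
        _ = _ := by ring
    have hz : 0 < zeta a b l ^ σ := Real.rpow_pos_of_pos (zeta_pos a b l) σ
    have s1 : Summable fun m => zeta a b l ^ σ * ‖d m * c (l - m)‖ :=
      Summable.of_nonneg_of_le (fun m => by positivity) hb ((h1 l).mul_left _)
    have s2 : Summable fun m => ‖d m * c (l - m)‖ := (summable_mul_left_iff hz.ne').1 s1
    calc zeta a b l ^ σ * ‖convC d c l‖ ≤ zeta a b l ^ σ * ∑' m, ‖d m * c (l - m)‖ := by
          gcongr; exact norm_tsum_le_tsum_norm s2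
      _ = ∑' m, zeta a b l ^ σ * ‖d m * c (l - m)‖ := by rw [tsum_mul_left]
      _ ≤ ∑' m, 2 ^ σ * ((zeta a b m ^ σ * ‖d m‖) * (zeta a b (l - m) ^ σ * ‖c (l - m)‖)) :=
          s1.tsum_le_tsum hb ((h1 l).mul_left _)
      _ = _ := by rw [tsum_mul_left]
  calc _ ≤ ∑ l ∈ S, (2 ^ σ * ∑' m, (zeta a b m ^ σ * ‖d m‖) *
          (zeta a b (l - m) ^ σ * ‖c (l - m)‖)) ^ 2 :=
        Finset.sum_le_sum fun l _ => pow_le_pow_left₀ (wn_nonneg a b σ _ l) (key l) 2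
    _ = (2 ^ σ) ^ 2 * ∑ l ∈ S, (∑' m, (zeta a b m ^ σ * ‖d m‖) *
          (zeta a b (l - m) ^ σ * ‖c (l - m)‖)) ^ 2 := by
        rw [Finset.mul_sum]; exact Finset.sum_congr rfl fun l _ => by ring
    _ ≤ (2 ^ σ) ^ 2 * (Zc a b * B * A) ^ 2 := mul_le_mul_of_nonneg_left (h2 S) (by positivity)
    _ = _ := by ring

lemma conv_alg {a b σ A B : ℝ} {c d : ℤ → ℂ} (hab : a < b) (hσ : 0 ≤ σ)
    (hc : Hb a b (σ + 1) c A) (hd : Hb a b (σ + 1) d B) :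
    Hb a b (σ + 1) (convC c d) (2 * 2 ^ (σ + 1) * Zc a b * A * B) := by
  have hZ := Zc_nonneg a b
  have hA := hc.1
  have hB := hd.1
  have hc0 : Hb a b (0 + 1) c A := hc.mono (by linarith)
  have hd0 : Hb a b (0 + 1) d B := hd.mono (by linarith)
  have lc := fun S => hc0.l1 hab S
  have ld := fun S => hd0.l1 hab S
  simp only [Real.rpow_zero, one_mul] at lc ld
  set ρ := σ + 1 with hρ
  have hρ0 : 0 ≤ ρ := by linarith
  obtain ⟨h1, h2⟩ := young (fun l => norm_nonneg (c l)) (wn_nonneg a b ρ d) hB lc hd.2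
  obtain ⟨h3, h4⟩ := young (fun l => norm_nonneg (d l)) (wn_nonneg a b ρ c) hA ld hc.2
  refine ⟨by positivity, fun S => ?_⟩
  have key : ∀ l, zeta a b l ^ ρ * ‖convC c d l‖ ≤
      2 ^ ρ * ∑' m, ‖c m‖ * (zeta a b (l - m) ^ ρ * ‖d (l - m)‖) +
      2 ^ ρ * ∑' m, ‖d m‖ * (zeta a b (l - m) ^ ρ * ‖c (l - m)‖) := by
    intro l
    have h3' : Summable fun m => ‖d (l - m)‖ * (zeta a b m ^ ρ * ‖c m‖) := by
      have := (Equiv.subLeft l).summable_iff.2 (h3 l)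
      simpa [Function.comp_def] using this
    have e3 : ∑' m, ‖d m‖ * (zeta a b (l - m) ^ ρ * ‖c (l - m)‖) =
        ∑' m, ‖d (l - m)‖ * (zeta a b m ^ ρ * ‖c m‖) := by
      rw [← (Equiv.subLeft l).tsum_eq]
      simp
    have hb : ∀ m, zeta a b l ^ ρ * ‖c m * d (l - m)‖ ≤
        2 ^ ρ * (‖c m‖ * (zeta a b (l - m) ^ ρ * ‖d (l - m)‖)) +
        2 ^ ρ * (‖d (l - m)‖ * (zeta a b m ^ ρ * ‖c m‖)) := by
      intro m
      rw [norm_mul]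
      calc _ ≤ (2 ^ ρ * (zeta a b m ^ ρ + zeta a b (l - m) ^ ρ)) * (‖c m‖ * ‖d (l - m)‖) := by
            gcongr; exact zeta_alg a b ρ hρ0 l m
        _ = _ := by ring
    have hz : 0 < zeta a b l ^ ρ := Real.rpow_pos_of_pos (zeta_pos a b l) ρ
    have sr := ((h1 l).mul_left (2 ^ ρ)).add (h3'.mul_left (2 ^ ρ))
    have s1 : Summable fun m => zeta a b l ^ ρ * ‖c m * d (l - m)‖ :=
      Summable.of_nonneg_of_le (fun m => by positivity) hb sr
    have s2 : Summable fun m => ‖c m * d (l - m)‖ := (summable_mul_left_iff hz.ne').1 s1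
    calc zeta a b l ^ ρ * ‖convC c d l‖ ≤ zeta a b l ^ ρ * ∑' m, ‖c m * d (l - m)‖ := by
          gcongr; exact norm_tsum_le_tsum_norm s2
      _ = ∑' m, zeta a b l ^ ρ * ‖c m * d (l - m)‖ := by rw [tsum_mul_left]
      _ ≤ ∑' m, _ := s1.tsum_le_tsum hb sr
      _ = _ := by
        rw [((h1 l).mul_left (2 ^ ρ)).tsum_add (h3'.mul_left (2 ^ ρ)), tsum_mul_left, tsum_mul_left,
          e3]
  have e : 2 * 2 ^ ρ * Zc a b * A * B = 2 ^ ρ * (Zc a b * A * B) + 2 ^ ρ * (Zc a b * B * A) := by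
    ring
  rw [e]
  refine l2_add (by positivity) (by positivity) (wn_nonneg a b ρ _) ?_ ?_ key
  · simp only [mul_pow _ (tsum _)]
    rw [← Finset.mul_sum, mul_pow (2 ^ ρ)]
    exact mul_le_mul_of_nonneg_left (h2 S) (by positivity)
  · simp only [mul_pow _ (tsum _)]
    rw [← Finset.mul_sum, mul_pow (2 ^ ρ)]
    exact mul_le_mul_of_nonneg_left (h4 S) (by positivity)

lemma Hb.mvt {a b σ B R : ℝ} {X X' : ℝ → ℤ → ℂ} (hR : 0 ≤ R)
    (hX : ∀ t, 0 ≤ t → t ≤ R → ∀ l, HasDerivAt (fun r => X r l) (X' t l) t)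
    (hB : ∀ t, 0 ≤ t → t ≤ R → Hb a b σ (X' t) B) :
    Hb a b σ (fun l => X R l - X 0 l) (B * R) := by
  have hB0 : 0 ≤ B := (hB 0 le_rfl hR).1
  refine ⟨by positivity, fun S => ?_⟩
  set y : ℤ → ℂ := fun l => X R l - X 0 l with hy
  set Y := ∑ l ∈ S, (zeta a b l ^ σ * ‖y l‖) ^ 2 with hY
  have hY0 : 0 ≤ Y := Finset.sum_nonneg fun _ _ => by positivity
  set Φ : ℝ → ℂ := fun t => ∑ l ∈ S, ((((zeta a b l ^ σ) ^ 2 : ℝ) : ℂ) * (starRingEnd ℂ) (y l)) * X t l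
    with hΦ
  have hd : ∀ t ∈ Set.Icc 0 R, HasDerivWithinAt Φ
      (∑ l ∈ S, ((((zeta a b l ^ σ) ^ 2 : ℝ) : ℂ) * (starRingEnd ℂ) (y l)) * X' t l) (Set.Icc 0 R) t := by
    intro t ht
    refine HasDerivAt.hasDerivWithinAt ?_
    exact HasDerivAt.fun_sum fun l _ => (hX t ht.1 ht.2 l).const_mul _
  have hb : ∀ t ∈ Set.Ico 0 R,
      ‖∑ l ∈ S, ((((zeta a b l ^ σ) ^ 2 : ℝ) : ℂ) * (starRingEnd ℂ) (y l)) * X' t l‖ ≤ Real.sqrt Y * B := by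
    intro t ht
    refine (norm_sum_le _ _).trans ?_
    apply le_of_sq_le_sq _ (by positivity)
    rw [mul_pow, Real.sq_sqrt hY0]
    have e : ∀ l, ‖((((zeta a b l ^ σ) ^ 2 : ℝ) : ℂ) * (starRingEnd ℂ) (y l)) * X' t l‖ =
        (zeta a b l ^ σ * ‖y l‖) * (zeta a b l ^ σ * ‖X' t l‖) := by
      intro l
      rw [norm_mul, norm_mul, Complex.norm_real, RCLike.norm_conj, Real.norm_of_nonneg (by positivity)]
      ring
    simp only [e]
    refine (Finset.sum_mul_sq_le_sq_mul_sq S _ _).trans ?_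
    exact mul_le_mul_of_nonneg_left ((hB t ht.1 ht.2.le).2 S) hY0
  have := norm_image_sub_le_of_norm_deriv_le_segment' hd hb R ⟨hR, le_rfl⟩
  have e : Φ R - Φ 0 = ((Y : ℝ) : ℂ) := by
    rw [hΦ, hY]
    simp only
    rw [← Finset.sum_sub_distrib]
    push_cast
    refine Finset.sum_congr rfl fun l _ => ?_
    rw [← mul_sub, show X R l - X 0 l = y l from rfl, mul_assoc, mul_comm _ (y l), Complex.mul_conj,
      Complex.normSq_eq_norm_sq]
    push_cast
    ring
  rw [e, Complex.norm_real, Real.norm_of_nonneg hY0, sub_zero] at this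
  have h2 : Real.sqrt Y ≤ B * R := by
    rcases (Real.sqrt_nonneg Y).eq_or_lt with h0 | h0
    · rw [← h0]; positivity
    · have h3 : Real.sqrt Y * Real.sqrt Y ≤ Real.sqrt Y * (B * R) := by
        rw [Real.mul_self_sqrt hY0]; linarith
      exact le_of_mul_le_mul_left h3 h0
  rwa [Real.sqrt_le_left (by positivity)] at h2

/-- product constant -/
def Qc (a b s : ℝ) : ℝ := 2 * 2 ^ (s + 1) * Zc a b

lemma Qc_nonneg (a b s : ℝ) : 0 ≤ Qc a b s := by
  have := Zc_nonneg a b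
  unfold Qc; positivity

lemma cA {a b s A B : ℝ} {c d : ℤ → ℂ} (hab : a < b) (hs : 1 ≤ s)
    (hc : Hb a b (s + 1) c A) (hd : Hb a b (s + 1) d B) :
    Hb a b (s + 1) (convC c d) (Qc a b s * A * B) :=
  conv_alg hab (by linarith) hc hd

lemma cS {a b s A B : ℝ} {c d : ℤ → ℂ} (hab : a < b) (hs : 1 ≤ s)
    (hc : Hb a b (s + 1) c A) (hd : Hb a b s d B) :
    Hb a b s (convC c d) (Qc a b s * A * B) := by
  have hA := hc.1
  have hB := hd.1
  have hZ := Zc_nonneg a b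
  refine (conv_peetre hab (by linarith) hd hc).le ?_
  unfold Qc
  gcongr
  have : (2:ℝ) ^ s ≤ 2 ^ (s + 1) := Real.rpow_le_rpow_of_exponent_le (by norm_num) (by linarith)
  have h2 : (0:ℝ) < 2 ^ s := by positivity
  linarith

lemma cS1 {a b s A B : ℝ} {c d : ℤ → ℂ} (hab : a < b) (hs : 1 ≤ s)
    (hc : Hb a b s c A) (hd : Hb a b (s - 1) d B) :
    Hb a b (s - 1) (convC c d) (Qc a b s * A * B) := by
  have hA := hc.1
  have hB := hd.1
  have hZ := Zc_nonneg a b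
  have hc' : Hb a b (s - 1 + 1) c A := by rwa [sub_add_cancel]
  refine (conv_peetre hab (by linarith) hd hc').le ?_
  unfold Qc
  gcongr
  have : (2:ℝ) ^ (s - 1) ≤ 2 ^ (s + 1) :=
    Real.rpow_le_rpow_of_exponent_le (by norm_num) (by linarith)
  have h2 : (0:ℝ) < 2 ^ (s - 1) := by positivity
  linarith

/-- Symmetric triple with bounded first and second differences. -/
structure Tri (a b s r : ℝ) (f g h : ℤ → ℂ) (A : ℝ) : Prop where
  hf : Hb a b (s + 1) f A
  hg : Hb a b (s + 1) g A
  hh : Hb a b (s + 1) h A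
  h1 : Hb a b s (fun l => f l - h l) (A * r)
  h2 : Hb a b s (fun l => g l - h l) (A * r)
  h3 : Hb a b (s - 1) (fun l => f l + h l - 2 * g l) (A * r ^ 2)

lemma hasSum_congr_fun {f g : ℤ → ℂ} {x : ℂ} (h : ∀ m, f m = g m) (hf : HasSum f x) :
    HasSum g x := (funext h : f = g) ▸ hf

lemma conv_diff {f h f' h' : ℤ → ℂ} (sf : Summable fun l => ‖f l‖) (sh : Summable fun l => ‖h l‖)
    (sf' : Summable fun l => ‖f' l‖) (sh' : Summable fun l => ‖h' l‖) (l : ℤ) :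
    convC f f' l - convC h h' l =
      convC f (fun l => f' l - h' l) l + convC h' (fun l => f l - h l) l := by
  have s1 : Summable fun l => ‖f' l - h' l‖ :=
    Summable.of_nonneg_of_le (fun _ => norm_nonneg _) (fun _ => norm_sub_le _ _) (sf'.add sh')
  have s2 : Summable fun l => ‖f l - h l‖ :=
    Summable.of_nonneg_of_le (fun _ => norm_nonneg _) (fun _ => norm_sub_le _ _) (sf.add sh)
  rw [convC_comm h']
  refine ((summable_conv sf sf' l).sub (summable_conv sh sh' l)).unique ?_
  refine hasSum_congr_fun (fun m => ?_) ((summable_conv sf s1 l).add (summable_conv s2 sh' l))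
  ring

lemma conv_diff2 {f g h f' g' h' : ℤ → ℂ} (sf : Summable fun l => ‖f l‖)
    (sg : Summable fun l => ‖g l‖) (sh : Summable fun l => ‖h l‖)
    (sf' : Summable fun l => ‖f' l‖) (sg' : Summable fun l => ‖g' l‖)
    (sh' : Summable fun l => ‖h' l‖) (l : ℤ) :
    convC f f' l + convC h h' l - 2 * convC g g' l =
      convC f' (fun l => f l + h l - 2 * g l) l + convC g (fun l => f' l + h' l - 2 * g' l) l
        + convC (fun l => g l - h l) (fun l => f' l - h' l) l := by
  have aux : ∀ x y z : ℤ → ℂ, (Summable fun l => ‖x l‖) → (Summable fun l => ‖y l‖) →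
      (Summable fun l => ‖z l‖) → Summable fun l => ‖x l + z l - 2 * y l‖ := by
    intro x y z hx hy hz
    refine Summable.of_nonneg_of_le (fun _ => norm_nonneg _) (fun l => ?_)
      ((hx.add hz).add (hy.mul_left 2))
    refine (norm_sub_le _ _).trans (add_le_add (norm_add_le _ _) ?_)
    rw [norm_mul]; simp
  have s1 : Summable fun l => ‖f' l - h' l‖ :=
    Summable.of_nonneg_of_le (fun _ => norm_nonneg _) (fun _ => norm_sub_le _ _) (sf'.add sh')
  have s2 : Summable fun l => ‖g l - h l‖ :=
    Summable.of_nonneg_of_le (fun _ => norm_nonneg _) (fun _ => norm_sub_le _ _) (sg.add sh)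
  rw [convC_comm f' _]
  refine (((summable_conv sf sf' l).add (summable_conv sh sh' l)).sub
    ((summable_conv sg sg' l).mul_left 2)).unique ?_
  refine hasSum_congr_fun (fun m => ?_) (((summable_conv (aux f g h sf sg sh) sf' l).add
    (summable_conv sg (aux f' g' h' sf' sg' sh') l)).add (summable_conv s2 s1 l))
  ring

lemma Hb.summable' {a b s A : ℝ} {x : ℤ → ℂ} (hab : a < b) (hs : 1 ≤ s)
    (hx : Hb a b (s + 1) x A) : Summable fun l => ‖x l‖ :=
  hx.summable hab (by linarith)

lemma Tri.conv {a b s r A B : ℝ} {f g h f' g' h' : ℤ → ℂ} (hab : a < b) (hs : 1 ≤ s)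
    (hr : 0 ≤ r) (T : Tri a b s r f g h A) (T' : Tri a b s r f' g' h' B) :
    Tri a b s r (convC f f') (convC g g') (convC h h') (3 * Qc a b s * A * B) := by
  have hQ := Qc_nonneg a b s
  have hA := T.hf.1
  have hB := T'.hf.1
  have hAB : 0 ≤ Qc a b s * A * B := by positivity
  have sf := T.hf.summable' hab hs
  have sg := T.hg.summable' hab hs
  have sh := T.hh.summable' hab hs
  have sf' := T'.hf.summable' hab hs
  have sg' := T'.hg.summable' hab hs
  have sh' := T'.hh.summable' hab hs
  have le3 : Qc a b s * A * B ≤ 3 * Qc a b s * A * B := by nlinarith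
  refine ⟨(cA hab hs T.hf T'.hf).le le3, (cA hab hs T.hg T'.hg).le le3,
    (cA hab hs T.hh T'.hh).le le3, ?_, ?_, ?_⟩
  · simp only [conv_diff sf sh sf' sh']
    refine ((cS hab hs T.hf T'.h1).add (cS hab hs T'.hh T.h1)).le ?_
    have : 0 ≤ Qc a b s * A * B * r := by positivity
    nlinarith
  · simp only [conv_diff sg sh sg' sh']
    refine ((cS hab hs T.hg T'.h2).add (cS hab hs T'.hh T.h2)).le ?_
    have : 0 ≤ Qc a b s * A * B * r := by positivity
    nlinarith
  · simp only [conv_diff2 sf sg sh sf' sg' sh']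
    refine (((cS1 hab hs (T'.hf.mono (by linarith)) T.h3).add
      (cS1 hab hs (T.hg.mono (by linarith)) T'.h3)).add
      (cS1 hab hs T.h2 (T'.h1.mono (by linarith)))).le (le_of_eq ?_)
    ring

lemma Hb.zero (a b σ : ℝ) {B : ℝ} {x : ℤ → ℂ} (hB : 0 ≤ B) (hx : ∀ l, x l = 0) : Hb a b σ x B :=
  ⟨hB, fun S => by simp only [hx]; simp; positivity⟩

lemma Tri.pow {a b s r A : ℝ} {f g h : ℤ → ℂ} (hab : a < b) (hs : 1 ≤ s)
    (hr : 0 ≤ r) (T : Tri a b s r f g h A) (n : ℕ) :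
    Tri a b s r (powC f n) (powC g n) (powC h n) ((3 * Qc a b s * A) ^ n) := by
  induction n with
  | zero =>
    simp only [pow_zero, powC]
    exact ⟨Hb.one _ _ _, Hb.one _ _ _, Hb.one _ _ _, Hb.zero _ _ _ (by positivity) (by simp),
      Hb.zero _ _ _ (by positivity) (by simp), Hb.zero _ _ _ (by positivity) (fun l => by ring)⟩
  | succ n ih =>
    have := T.conv hab hs hr ih
    rw [pow_succ']
    exact this

lemma Hb.pow {a b s A : ℝ} {f : ℤ → ℂ} (hab : a < b) (hs : 1 ≤ s) (hf : Hb a b (s + 1) f A)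
    (n : ℕ) : Hb a b (s + 1) (powC f n) ((3 * Qc a b s * A) ^ n) := by
  have hA := hf.1
  have T : Tri a b s 0 f f f A := ⟨hf, hf, hf, Hb.zero _ _ _ (by positivity) (by simp),
      Hb.zero _ _ _ (by positivity) (by simp), Hb.zero _ _ _ (by positivity) (fun l => by ring)⟩
  exact (T.pow hab hs le_rfl n).hf

lemma pow_lip {a b s A : ℝ} (hab : a < b) (hs : 1 ≤ s) (hA : 0 ≤ A) (n : ℕ) :
    ∃ L, 0 ≤ L ∧ ∀ (f g : ℤ → ℂ) (δ : ℝ), Hb a b (s + 1) f A → Hb a b (s + 1) g A →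
      Hb a b (s - 1) (fun l => f l - g l) δ →
      Hb a b (s - 1) (fun l => powC f n l - powC g n l) (L * δ) := by
  have hQ := Qc_nonneg a b s
  induction n with
  | zero =>
    exact ⟨0, le_rfl, fun f g δ _ _ _ => Hb.zero _ _ _ (by simp) (by simp [powC])⟩
  | succ n ih =>
    obtain ⟨L, hL, ih⟩ := ih
    refine ⟨Qc a b s * A * L + Qc a b s * (3 * Qc a b s * A) ^ n, by positivity, ?_⟩
    intro f g δ hf hg hd
    have pf := hf.pow hab hs n
    have pg := hg.pow hab hs n
    simp only [powC, conv_diff (hf.summable' hab hs) (hg.summable' hab hs)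
      (pf.summable' hab hs) (pg.summable' hab hs)]
    refine ((cS1 hab hs (hf.mono (by linarith)) (ih f g δ hf hg hd)).add
      (cS1 hab hs (pg.mono (by linarith)) hd)).le (le_of_eq ?_)
    ring

lemma conjC_convC (c d : ℤ → ℂ) : conjC (convC c d) = convC (conjC c) (conjC d) := by
  funext l
  unfold conjC convC
  rw [Complex.conj_tsum, ← (Equiv.neg ℤ).tsum_eq]
  refine tsum_congr fun m => ?_
  simp only [Equiv.neg_apply, map_mul]
  congr 3
  ring

lemma conjC_reC (c : ℤ → ℂ) : conjC (reC c) = reC c := by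
  funext l
  simp [conjC, reC, add_comm, map_ofNat (starRingEnd ℂ) 2]

lemma conjC_pow (c : ℤ → ℂ) (n : ℕ) : conjC (powC (reC c) n) = powC (reC c) n := by
  induction n with
  | zero =>
    funext l
    simp only [powC, conjC, oneC]
    split_ifs <;> simp_all
  | succ n ih =>
    simp only [powC]
    rw [conjC_convC, ih, conjC_reC]

lemma conj_Gop (p : ℕ) (c : ℤ → ℂ) (l : ℤ) : (starRingEnd ℂ) (Gop p c (-l)) = Gop p c l :=
  congrFun (conjC_pow c (p + 1)) l

/-- first derivative of the real part -/
def V1 (a b : ℝ) (c : ℤ → ℂ) : ℤ → ℂ :=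
  fun l => Complex.I * (zeta a b l : ℂ) * ((c l - conjC c l) / 2)

/-- second derivative of the real part -/
def V2 (a b : ℝ) (p : ℕ) (ε : ℝ) (c : ℤ → ℂ) : ℤ → ℂ :=
  fun l => -((zeta a b l : ℂ) ^ 2 * reC c l) - (ε ^ p : ℂ) * Gop p c l

lemma sol_conj {a b ε : ℝ} {p : ℕ} {Ψ : ℝ → ℤ → ℂ} (h : IsExactSol a b p ε Ψ) (t : ℝ) (l : ℤ) :
    HasDerivAt (fun r => conjC (Ψ r) l)
      (-Complex.I * ((zeta a b l : ℂ) * conjC (Ψ t) l + (ε ^ p : ℂ) * Gop p (Ψ t) l /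
        (zeta a b l : ℂ))) t := by
  have := (h t (-l)).star
  have e : star (Complex.I * ((zeta a b (-l) : ℂ) * Ψ t (-l) + (ε ^ p : ℂ) * Gop p (Ψ t) (-l) /
        (zeta a b (-l) : ℂ))) = -Complex.I * ((zeta a b l : ℂ) * conjC (Ψ t) l +
        (ε ^ p : ℂ) * Gop p (Ψ t) l / (zeta a b l : ℂ)) := by
    rw [← conj_Gop p (Ψ t) l, zeta_neg]
    simp [conjC]
  rw [e] at this
  exact this

lemma sol_d1 {a b ε : ℝ} {p : ℕ} {Ψ : ℝ → ℤ → ℂ} (h : IsExactSol a b p ε Ψ) (t : ℝ) (l : ℤ) :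
    HasDerivAt (fun r => reC (Ψ r) l) (V1 a b (Ψ t) l) t := by
  refine (((h t l).add (sol_conj h t l)).div_const 2).congr_deriv ?_
  unfold V1; ring

lemma sol_d2 {a b ε : ℝ} {p : ℕ} {Ψ : ℝ → ℤ → ℂ} (h : IsExactSol a b p ε Ψ) (t : ℝ) (l : ℤ) :
    HasDerivAt (fun r => V1 a b (Ψ r) l) (V2 a b p ε (Ψ t) l) t := by
  refine ((((h t l).sub (sol_conj h t l)).div_const 2).const_mul
    (Complex.I * (zeta a b l : ℂ))).congr_deriv ?_
  have hz : (zeta a b l : ℂ) ≠ 0 := by exact_mod_cast (zeta_pos a b l).ne'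
  unfold V2 reC
  field_simp
  ring_nf
  simp only [Complex.I_sq]
  ring

lemma V1_bd {a b s K : ℝ} {c : ℤ → ℂ} (h : Hb a b (s + 1) c K) : Hb a b s (V1 a b c) K := by
  have := ((h.sub h.conj).J).smul (Complex.I / 2)
  have h2 : ‖(Complex.I / 2 : ℂ)‖ * (K + K) = K := by simp; ring
  rw [h2] at this
  exact this.congr fun l => by unfold V1; congr 2; ring

lemma V2_bd {a b s K ε C : ℝ} {p : ℕ} {c : ℤ → ℂ} (h0 : 0 ≤ ε) (h1 : ε ≤ 1)
    (h : Hb a b (s + 1) c K) (hG : Hb a b (s + 1) (Gop p c) C) :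
    Hb a b (s - 1) (V2 a b p ε c) (K + C) := by
  have hr := h.re
  rw [show s + 1 = s - 1 + 1 + 1 by ring] at hr
  have h2 : Hb a b (s - 1) (fun l => (ε ^ p : ℂ) * Gop p c l) C := by
    refine ((hG.mono (by linarith : s - 1 ≤ s + 1)).smul (ε ^ p : ℂ)).le ?_
    have : ‖(ε ^ p : ℂ)‖ ≤ 1 := by
      rw [norm_pow, Complex.norm_real, Real.norm_of_nonneg h0]
      exact pow_le_one₀ h0 h1
    have hC := hG.1
    nlinarith
  refine (hr.J.J.neg.sub h2).congr fun l => ?_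
  unfold V2; congr 2; ring

lemma expJ_sol (a b t₀ : ℝ) (p : ℕ) (hp : 1 ≤ p) (c : ℤ → ℂ) :
    IsExactSol a b p 0 (fun t => expJ a b (t - t₀) c) := by
  intro t l
  have h1 : HasDerivAt (fun r : ℝ => Complex.I * (((r - t₀ : ℝ)) : ℂ) * (zeta a b l : ℂ))
      (Complex.I * 1 * (zeta a b l : ℂ)) t := by
    have : HasDerivAt (fun r : ℝ => (((r - t₀ : ℝ)) : ℂ)) ((1 : ℝ) : ℂ) t :=
      ((hasDerivAt_id t).sub_const t₀).ofReal_comp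
    simpa using (this.const_mul Complex.I).mul_const (zeta a b l : ℂ)
  refine (h1.cexp.mul_const (c l)).congr_deriv ?_
  have : ((0 : ℝ) : ℂ) ^ p = 0 := by
    rw [Complex.ofReal_zero]; exact zero_pow (by omega)
  rw [this]
  simp only [expJ]
  ring

lemma norm_expI (t z : ℝ) : ‖Complex.exp (Complex.I * (t : ℂ) * (z : ℂ))‖ = 1 := by
  have : Complex.I * (t : ℂ) * (z : ℂ) = ((t * z : ℝ) : ℂ) * Complex.I := by push_cast; ring
  rw [this, Complex.norm_exp_ofReal_mul_I]

lemma Hb.expJ {a b σ A : ℝ} {c : ℤ → ℂ} (h : Hb a b σ c A) (t : ℝ) :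
    Hb a b σ (expJ a b t c) A :=
  h.congr fun l => by unfold NKGE.expJ; rw [norm_mul, norm_expI, one_mul]

/-- `Ψ` bounded on an interval -/
def BdOn (a b s K : ℝ) (Ψ : ℝ → ℤ → ℂ) (α β : ℝ) : Prop :=
  ∀ t, α ≤ t → t ≤ β → Hb a b (s + 1) (Ψ t) K

lemma G_bd {a b s K : ℝ} {c : ℤ → ℂ} (hab : a < b) (hs : 1 ≤ s) (p : ℕ)
    (h : Hb a b (s + 1) c K) :
    Hb a b (s + 1) (Gop p c) ((3 * Qc a b s * K) ^ (p + 1)) :=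
  h.re.pow hab hs (p + 1)

lemma sol_lip {a b s K ε t₁ t₂ : ℝ} {p : ℕ} {Ψ : ℝ → ℤ → ℂ} (h : IsExactSol a b p ε Ψ)
    (ht : t₁ ≤ t₂) (hB : BdOn a b s K Ψ t₁ t₂) :
    Hb a b s (fun l => reC (Ψ t₂) l - reC (Ψ t₁) l) (K * (t₂ - t₁)) := by
  have := Hb.mvt (a := a) (b := b) (σ := s) (B := K) (R := t₂ - t₁)
    (X := fun r => reC (Ψ (t₁ + r))) (X' := fun r => V1 a b (Ψ (t₁ + r))) (by linarith)
    (fun t _ _ l => (sol_d1 h (t₁ + t) l).comp_const_add t₁ t)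
    (fun t h0 h1 => V1_bd (hB _ (by linarith) (by linarith)))
  simpa using this

lemma sol_tri {a b s K ε c R C : ℝ} {p : ℕ} {Ψ : ℝ → ℤ → ℂ} (h0 : 0 ≤ ε)
    (h1 : ε ≤ 1) (h : IsExactSol a b p ε Ψ) (hR : 0 ≤ R) (hB : BdOn a b s K Ψ (c - R) (c + R))
    (hG : ∀ t, c - R ≤ t → t ≤ c + R → Hb a b (s + 1) (Gop p (Ψ t)) C) :
    Tri a b s R (reC (Ψ (c + R))) (reC (Ψ c)) (reC (Ψ (c - R))) (2 * (K + C)) := by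
  have hK : 0 ≤ K := (hB c (by linarith) (by linarith)).1
  have hC : 0 ≤ C := (hG c (by linarith) (by linarith)).1
  have hle : K ≤ 2 * (K + C) := by linarith
  have d1 : ∀ t l, HasDerivAt (fun r => reC (Ψ (c + r)) l) (V1 a b (Ψ (c + t)) l) t :=
    fun t l => (sol_d1 h (c + t) l).comp_const_add c t
  have d1' : ∀ t l, HasDerivAt (fun r => reC (Ψ (c - r)) l) (-V1 a b (Ψ (c - t)) l) t :=
    fun t l => (sol_d1 h (c - t) l).comp_const_sub c t
  have d2 : ∀ t l, HasDerivAt (fun r => V1 a b (Ψ (c + r)) l) (V2 a b p ε (Ψ (c + t)) l) t :=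
    fun t l => (sol_d2 h (c + t) l).comp_const_add c t
  have d2' : ∀ t l, HasDerivAt (fun r => V1 a b (Ψ (c - r)) l) (-V2 a b p ε (Ψ (c - t)) l) t :=
    fun t l => (sol_d2 h (c - t) l).comp_const_sub c t
  have b2 : ∀ t, c - R ≤ t → t ≤ c + R → Hb a b (s - 1) (V2 a b p ε (Ψ t)) (K + C) :=
    fun t ht ht' => V2_bd h0 h1 (hB t ht ht') (hG t ht ht')
  have inner : ∀ r, 0 ≤ r → r ≤ R →
      Hb a b (s - 1) (fun l => V1 a b (Ψ (c + r)) l - V1 a b (Ψ (c - r)) l) (2 * (K + C) * R) := by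
    intro r hr hrR
    have := Hb.mvt (a := a) (b := b) (σ := s - 1) (B := (K + C) + (K + C)) (R := r)
      (X := fun r l => V1 a b (Ψ (c + r)) l - V1 a b (Ψ (c - r)) l)
      (X' := fun t l => V2 a b p ε (Ψ (c + t)) l - -V2 a b p ε (Ψ (c - t)) l) hr
      (fun t _ _ l => (d2 t l).sub (d2' t l))
      (fun t h0 h1 => (b2 _ (by linarith) (by linarith)).sub (b2 _ (by linarith) (by linarith)).neg)
    simp only [add_zero, sub_zero, sub_self] at this
    refine this.le ?_
    nlinarith
  refine ⟨(hB _ (by linarith) (by linarith)).re.le hle, (hB _ (by linarith) (by linarith)).re.le hle,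
    (hB _ (by linarith) (by linarith)).re.le hle, ?_, ?_, ?_⟩
  · refine (sol_lip h (by linarith) hB).le ?_
    nlinarith
  · refine (sol_lip h (by linarith) (fun t ht ht' => hB t ht (by linarith))).le ?_
    nlinarith
  · have := Hb.mvt (a := a) (b := b) (σ := s - 1) (B := 2 * (K + C) * R) (R := R)
      (X := fun r l => reC (Ψ (c + r)) l + reC (Ψ (c - r)) l)
      (X' := fun t l => V1 a b (Ψ (c + t)) l + -V1 a b (Ψ (c - t)) l) hR
      (fun t _ _ l => (d1 t l).add (d1' t l))
      (fun t h0 h1 => by simpa only [sub_eq_add_neg] using inner t h0 h1)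
    simp only [add_zero, sub_zero] at this
    refine (this.le (by nlinarith : _ ≤ 2 * (K + C) * R ^ 2)).congr fun l => ?_
    congr 2; ring

lemma sol_cmp {a b s K ε ε' c R C : ℝ} {p : ℕ} {Ψ Φ : ℝ → ℤ → ℂ} (h0 : 0 ≤ ε)
    (h1 : ε ≤ 1) (h0' : 0 ≤ ε') (h1' : ε' ≤ 1) (h : IsExactSol a b p ε Ψ)
    (h' : IsExactSol a b p ε' Φ)
    (hR : 0 ≤ R) (hB : BdOn a b s K Ψ c (c + R)) (hB' : BdOn a b s K Φ c (c + R))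
    (hG : ∀ t, c ≤ t → t ≤ c + R → Hb a b (s + 1) (Gop p (Ψ t)) C)
    (hG' : ∀ t, c ≤ t → t ≤ c + R → Hb a b (s + 1) (Gop p (Φ t)) C) (e : Ψ c = Φ c) :
    Hb a b (s - 1) (fun l => reC (Ψ (c + R)) l - reC (Φ (c + R)) l) (2 * (K + C) * R ^ 2) := by
  have hK : 0 ≤ K := (hB c (by linarith) (by linarith)).1
  have hC : 0 ≤ C := (hG c (by linarith) (by linarith)).1
  have inner : ∀ r, 0 ≤ r → r ≤ R →
      Hb a b (s - 1) (fun l => V1 a b (Ψ (c + r)) l - V1 a b (Φ (c + r)) l) (2 * (K + C) * R) := by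
    intro r hr hrR
    have := Hb.mvt (a := a) (b := b) (σ := s - 1) (B := (K + C) + (K + C)) (R := r)
      (X := fun r l => V1 a b (Ψ (c + r)) l - V1 a b (Φ (c + r)) l)
      (X' := fun t l => V2 a b p ε (Ψ (c + t)) l - V2 a b p ε' (Φ (c + t)) l) hr
      (fun t _ _ l => ((sol_d2 h (c + t) l).comp_const_add c t).sub
        ((sol_d2 h' (c + t) l).comp_const_add c t))
      (fun t h2 h3 => (V2_bd h0 h1 (hB _ (by linarith) (by linarith))
        (hG _ (by linarith) (by linarith))).sub (V2_bd h0' h1' (hB' _ (by linarith) (by linarith))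
        (hG' _ (by linarith) (by linarith))))
    simp only [add_zero, e, sub_zero, sub_self] at this
    refine this.le ?_
    nlinarith
  have := Hb.mvt (a := a) (b := b) (σ := s - 1) (B := 2 * (K + C) * R) (R := R)
      (X := fun r l => reC (Ψ (c + r)) l - reC (Φ (c + r)) l)
      (X' := fun t l => V1 a b (Ψ (c + t)) l - V1 a b (Φ (c + t)) l) hR
      (fun t _ _ l => ((sol_d1 h (c + t) l).comp_const_add c t).sub
        ((sol_d1 h' (c + t) l).comp_const_add c t)) inner
  simp only [add_zero, e, sub_zero, sub_self] at this
  exact this.le (by nlinarith)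

/-- `i ζ⁻¹ e^{-itζ} g` -/
def hh (a b t : ℝ) (g : ℤ → ℂ) : ℤ → ℂ :=
  fun l => Complex.I * Complex.exp (Complex.I * ((-t : ℝ) : ℂ) * (zeta a b l : ℂ)) * g l /
    (zeta a b l : ℂ)

lemma hh_bd {a b σ A t : ℝ} {g : ℤ → ℂ} (h : Hb a b (σ - 1) g A) : Hb a b σ (hh a b t g) A :=
  h.congr fun l => by
    have hz := zeta_pos a b l
    have e : zeta a b l ^ σ = zeta a b l ^ (σ - 1) * zeta a b l := by
      rw [← zeta_rpow_succ, sub_add_cancel]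
    unfold hh
    rw [norm_div, norm_mul, norm_mul, norm_expI, Complex.norm_I, Complex.norm_real,
      Real.norm_of_nonneg hz.le, e]
    field_simp

lemma hh_diff2 {a b s r P c : ℝ} {f g h : ℤ → ℂ} (hr : 0 ≤ r)
    (T : Tri a b s r f g h P) :
    Hb a b s (fun l => hh a b (c + r) f l + hh a b (c - r) h l - 2 * hh a b c g l)
      (3 * P * r ^ 2) := by
  set E : ℤ → ℂ := fun l => Complex.exp (Complex.I * ((-r : ℝ) : ℂ) * (zeta a b l : ℂ)) with hE
  set E' : ℤ → ℂ := fun l => Complex.exp (Complex.I * (r : ℂ) * (zeta a b l : ℂ)) with hE'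
  set E0 : ℤ → ℂ := fun l => Complex.exp (Complex.I * ((-c : ℝ) : ℂ) * (zeta a b l : ℂ)) with hE0
  have nE : ∀ l, ‖E l‖ = 1 := fun l => norm_expI _ _
  have nE0 : ∀ l, ‖E0 l‖ = 1 := fun l => norm_expI _ _
  have EE : ∀ l, E l * E' l = 1 := by
    intro l
    simp only [hE, hE']
    rw [← Complex.exp_add, ← Complex.exp_zero]
    congr 1; push_cast; ring
  have bE' : ∀ l, ‖E' l - 1‖ ≤ r * zeta a b l := by
    intro l
    have := Real.norm_exp_I_mul_ofReal_sub_one_le (x := r * zeta a b l)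
    rw [Real.norm_of_nonneg (mul_nonneg hr (zeta_pos a b l).le)] at this
    simp only [hE']
    convert this using 4
    push_cast; ring
  have bEE : ∀ l, ‖E l + E' l - 2‖ ≤ (r * zeta a b l) ^ 2 := by
    intro l
    have e : E l + E' l - 2 = E l * (E' l - 1) ^ 2 := by
      linear_combination (2 - E' l) * EE l
    rw [e, norm_mul, nE, one_mul, norm_pow]
    exact pow_le_pow_left₀ (norm_nonneg _) (bE' l) 2
  have t1 : Hb a b s (fun l => hh a b c (fun l => f l + h l - 2 * g l) l) (P * r ^ 2) := hh_bd T.h3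
  have t2 : Hb a b s (fun l => Complex.I * E0 l * (E l + E' l - 2) * f l / (zeta a b l : ℂ))
      (r ^ 2 * P) := by
    refine T.hf.dom (by positivity) fun l => ?_
    have hz := zeta_pos a b l
    rw [norm_div, norm_mul, norm_mul, norm_mul, nE0, Complex.norm_I, Complex.norm_real,
      Real.norm_of_nonneg hz.le, zeta_rpow_succ]
    calc _ ≤ zeta a b l ^ s * (1 * 1 * (r * zeta a b l) ^ 2 * ‖f l‖ / zeta a b l) := by
          gcongr; exact bEE l
      _ = _ := by field_simp
  have t3 : Hb a b s (fun l => Complex.I * E0 l * (1 - E' l) * (f l - h l) / (zeta a b l : ℂ))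
      (r * (P * r)) := by
    refine T.h1.dom hr fun l => ?_
    have hz := zeta_pos a b l
    rw [norm_div, norm_mul, norm_mul, norm_mul, nE0, Complex.norm_I, Complex.norm_real,
      Real.norm_of_nonneg hz.le, norm_sub_rev 1]
    calc _ ≤ zeta a b l ^ s * (1 * 1 * (r * zeta a b l) * ‖f l - h l‖ / zeta a b l) := by
          gcongr; exact bE' l
      _ = _ := by field_simp
  refine (((t1.add t2).add t3).le (by nlinarith : _ ≤ 3 * P * r ^ 2)).congr fun l => ?_
  congr 2
  have e1 : Complex.exp (Complex.I * ((-(c + r) : ℝ) : ℂ) * (zeta a b l : ℂ)) = E0 l * E l := by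
    simp only [hE, hE0]; rw [← Complex.exp_add]; congr 1; push_cast; ring
  have e2 : Complex.exp (Complex.I * ((-(c - r) : ℝ) : ℂ) * (zeta a b l : ℂ)) = E0 l * E' l := by
    simp only [hE', hE0]; rw [← Complex.exp_add]; congr 1; push_cast; ring
  have e3 : Complex.exp (Complex.I * ((-c : ℝ) : ℂ) * (zeta a b l : ℂ)) = E0 l := rfl
  unfold hh
  rw [e1, e2, e3]
  ring

lemma w_deriv {a b ε : ℝ} {p : ℕ} {Ψ : ℝ → ℤ → ℂ} (h : IsExactSol a b p ε Ψ) (t : ℝ) (l : ℤ) :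
    HasDerivAt (fun r => expJ a b (-r) (Ψ r) l) ((ε ^ p : ℂ) * hh a b t (Gop p (Ψ t)) l) t := by
  have h1 : HasDerivAt (fun r : ℝ => Complex.I * (((-r : ℝ)) : ℂ) * (zeta a b l : ℂ))
      (Complex.I * (-1) * (zeta a b l : ℂ)) t := by
    have : HasDerivAt (fun r : ℝ => ((-r : ℝ) : ℂ)) ((-1 : ℝ) : ℂ) t :=
      ((hasDerivAt_id t).neg).ofReal_comp
    simpa using (this.const_mul Complex.I).mul_const (zeta a b l : ℂ)
  refine (h1.cexp.mul (h t l)).congr_deriv ?_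
  unfold hh
  ring

lemma strang_aux (a b : ℝ) (hab : a < b) (p : ℕ) (hp : 1 ≤ p)
    (s : ℝ) (hs : 1 ≤ s) (K : ℝ) (hK : 0 < K) :
    ∃ M₀ > 0, ∀ (ε : ℝ), 0 < ε → ε ≤ 1 → ∀ (R : ℝ), 0 < R →
      ∀ (t₀ : ℝ) (Ψ : ℝ → ℤ → ℂ), IsExactSol a b p ε Ψ →
        BdOn a b s K Ψ t₀ (t₀ + 2 * R) →
          Hb a b s (fun l => strang a b p ε (2 * R) (Ψ t₀) l - Ψ (t₀ + 2 * R) l)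
            (M₀ * ε ^ p * R ^ 3) := by
  obtain ⟨L, hL, lip⟩ := pow_lip hab hs hK.le (p + 1)
  have hQ := Qc_nonneg a b s
  set C := (3 * Qc a b s * K) ^ (p + 1) with hC
  have hC0 : 0 ≤ C := by positivity
  set P := (3 * Qc a b s * (2 * (K + C))) ^ (p + 1) with hP
  have hP0 : 0 ≤ P := by positivity
  refine ⟨3 * P + 4 * L * (K + C) + 1, by positivity, ?_⟩
  intro ε hε hε1 R hR t₀ Ψ h hB
  have hG : ∀ t, t₀ ≤ t → t ≤ t₀ + 2 * R → Hb a b (s + 1) (Gop p (Ψ t)) C :=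
    fun t h1 h2 => G_bd hab hs p (hB t h1 h2)
  set c := t₀ + R with hc
  set Φ : ℝ → ℤ → ℂ := fun t => expJ a b (t - t₀) (Ψ t₀) with hΦ
  have h' : IsExactSol a b p 0 Φ := expJ_sol a b t₀ p hp (Ψ t₀)
  have hBΦ : ∀ t, Hb a b (s + 1) (Φ t) K := fun t => (hB t₀ le_rfl (by linarith)).expJ _
  have hΦ0 : Ψ t₀ = Φ t₀ := by
    funext l; simp [hΦ, expJ]
  have ne : ‖(ε ^ p : ℂ)‖ = ε ^ p := by
    rw [norm_pow, Complex.norm_real, Real.norm_of_nonneg hε.le]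
  -- comparison of the two midpoint values
  have cmp := sol_cmp (R := R) hε.le hε1 le_rfl zero_le_one h h' hR.le
    (fun t h1 h2 => hB t h1 (by linarith)) (fun t _ _ => hBΦ t)
    (fun t h1 h2 => hG t h1 (by linarith)) (fun t _ _ => G_bd hab hs p (hBΦ t)) hΦ0
  have cmpG := lip _ _ _ (hB c (by linarith) (by linarith)).re (hBΦ c).re cmp
  have part2 := ((hh_bd (t := c) cmpG).smul (ε ^ p : ℂ)).smul (2 * R : ℂ)
  -- midpoint rule
  have d2 : ∀ r, 0 ≤ r → r ≤ R → Hb a b s (fun l => (ε ^ p : ℂ) *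
      (hh a b (c + r) (Gop p (Ψ (c + r))) l + hh a b (c - r) (Gop p (Ψ (c - r))) l -
        2 * hh a b c (Gop p (Ψ c)) l)) (ε ^ p * (3 * P * R ^ 2)) := by
    intro r hr hrR
    have T := (sol_tri (c := c) (R := r) hε.le hε1 h hr
      (fun t h1 h2 => hB t (by linarith) (by linarith))
      (fun t h1 h2 => hG t (by linarith) (by linarith))).pow hab hs hr (p + 1)
    have := (hh_diff2 (c := c) hr T).smul (ε ^ p : ℂ)
    rw [ne] at this
    refine this.le ?_
    gcongr
  have part1 := Hb.mvt (a := a) (b := b) (σ := s) (R := R)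
    (X := fun r l => expJ a b (-(c + r)) (Ψ (c + r)) l - expJ a b (-(c - r)) (Ψ (c - r)) l -
      (r : ℂ) * (2 * ((ε ^ p : ℂ) * hh a b c (Gop p (Ψ c)) l)))
    (X' := fun r l => (ε ^ p : ℂ) *
      (hh a b (c + r) (Gop p (Ψ (c + r))) l + hh a b (c - r) (Gop p (Ψ (c - r))) l -
        2 * hh a b c (Gop p (Ψ c)) l)) hR.le
    (fun t _ _ l => by
      have q1 := (w_deriv h (c + t) l).comp_const_add c t
      have q2 := (w_deriv h (c - t) l).comp_const_sub c t
      have q3 : HasDerivAt (fun r : ℝ => (r : ℂ)) ((1 : ℝ) : ℂ) t := (hasDerivAt_id t).ofReal_comp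
      refine ((q1.sub q2).sub (q3.mul_const (2 * ((ε ^ p : ℂ) * hh a b c (Gop p (Ψ c)) l)))).congr_deriv ?_
      push_cast
      ring) d2
  have tot := part1.add part2
  refine (tot.le ?_).congr fun l => ?_
  · have : ‖(2 * R : ℂ)‖ = 2 * R := by
      rw [norm_mul, Complex.norm_real, Real.norm_of_nonneg hR.le]; simp
    rw [this, ne]
    have : 0 ≤ ε ^ p * R ^ 3 := by positivity
    nlinarith
  · congr 1
    rw [← one_mul ‖strang _ _ _ _ _ _ _ - _‖, ← norm_expI (-(t₀ + 2 * R)) (zeta a b l), ← norm_mul,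
      ← norm_neg]
    congr 1
    have c1 : c + R = t₀ + 2 * R := by rw [hc]; ring
    have c2 : c - R = t₀ := by rw [hc]; ring
    have eΦ : expJ a b (2 * R / 2) (Ψ t₀) = Φ c := by
      simp only [hΦ]; congr 1; rw [hc]; ring
    have eG : Gop p (Ψ c) = powC (reC (Ψ c)) (p + 1) := rfl
    have eG' : Gop p (Φ c) = powC (reC (Φ c)) (p + 1) := rfl
    have x1 : Complex.exp (Complex.I * ((-(t₀ + 2 * R) : ℝ) : ℂ) * (zeta a b l : ℂ)) *
        Complex.exp (Complex.I * ((2 * R / 2 : ℝ) : ℂ) * (zeta a b l : ℂ)) =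
        Complex.exp (Complex.I * ((-c : ℝ) : ℂ) * (zeta a b l : ℂ)) := by
      rw [← Complex.exp_add]; congr 1; rw [hc]; push_cast; ring
    have x2 : Complex.exp (Complex.I * ((-c : ℝ) : ℂ) * (zeta a b l : ℂ)) *
        Complex.exp (Complex.I * ((c - t₀ : ℝ) : ℂ) * (zeta a b l : ℂ)) =
        Complex.exp (Complex.I * ((-t₀ : ℝ) : ℂ) * (zeta a b l : ℂ)) := by
      rw [← Complex.exp_add]; congr 1; push_cast; ring
    unfold strang
    rw [eΦ, c1, c2]
    simp only [add_zero, sub_zero, sub_self, Complex.ofReal_zero, zero_mul]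
    simp only [expJ, flowV, Fop, opJinv, hh, ← eG, ← eG', Complex.real_smul]
    rw [show Φ c l = Complex.exp (Complex.I * ((c - t₀ : ℝ) : ℂ) * (zeta a b l : ℂ)) * Ψ t₀ l from rfl,
      mul_sub, ← mul_assoc, x1, mul_add, ← mul_assoc, x2]
    push_cast
    ring



/-- **Lemma 3.3.** Local error of the Strang splitting: if the
exact solution `Ψ` of the relativistic NLSE is bounded by `K` in `H^{s+1}` on
`[0, T_ε]`, then `‖S_τ(ψ(t_n)) − S_{e,τ}(ψ(t_n))‖_s ≤ M₀ ε^p τ³` for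
`0 < τ ≤ 1/ε^p`, with `M₀` depending only on the `H^{s+1}` bound `K`. -/
theorem strang_local_error (a b : ℝ) (hab : a < b) (p : ℕ) (hp : 1 ≤ p)
    (s : ℝ) (hs : 1 ≤ s) (K : ℝ) (hK : 0 < K) :
    ∃ M₀ > 0, ∀ (ε : ℝ), 0 < ε → ε ≤ 1 →
      ∀ (τ : ℝ), 0 < τ → τ ≤ 1 / ε ^ p →
      ∀ (Tε : ℝ) (Ψ : ℝ → ℤ → ℂ), IsExactSol a b p ε Ψ →
        (∀ t : ℝ, 0 ≤ t → t ≤ Tε →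
          MemHs a b (s + 1) (Ψ t) ∧ sobNorm a b (s + 1) (Ψ t) ≤ K) →
        ∀ n : ℕ, (n : ℝ) * τ + τ ≤ Tε →
          sobNorm a b s
              (fun l => strang a b p ε τ (Ψ ((n : ℝ) * τ)) l - Ψ ((n : ℝ) * τ + τ) l) ≤
            M₀ * ε ^ p * τ ^ 3 := by

  obtain ⟨M, hM, key⟩ := strang_aux a b hab p hp s hs K hK
  refine ⟨M, hM, ?_⟩
  intro ε hε hε1 τ hτ _ Tε Ψ h hB n hn
  have hn0 : 0 ≤ (n : ℝ) * τ := by positivity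
  have := key ε hε hε1 (τ / 2) (by positivity) (n * τ) Ψ h (fun t h1 h2 => by
    obtain ⟨q1, q2⟩ := hB t (by linarith) (by linarith)
    exact Hb.of_mem hK.le q1 q2)
  rw [show 2 * (τ / 2) = τ by ring] at this
  refine this.sobNorm_le.trans ?_
  have h3 : (τ / 2) ^ 3 ≤ τ ^ 3 := pow_le_pow_left₀ (by positivity) (by linarith) 3
  exact mul_le_mul_of_nonneg_left h3 (by positivity)

end NKGE
end
end
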